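/- arXiv:math/0311512 — 2 statements merged into one kernel-verified Lean document; each statement's English description precedes it below -/
import Mathlib

section
/- Fix σ ∈ ℝ and k ∈ ℤ. (a) The assignment γ_i^{±1} ↦ 1, β_j ↦ 0 (j ≠ n), β_n ↦ (q^{−σ−2k} − q^{σ+2k})/(q − q^{-1}) extends to an algebra homomorphism (a character) χ : 𝒜 → ℂ. (b) The algebra homomorphism (χ ⊗ id) ∘ δ_𝒜 : 𝒜 → U_q(g) equals π_{σ+2k}. Consequently π_{σ+2k} ∘ π_σ^{-1} : 𝒜_σ → 𝒜_{σ+2k} is an algebra isomorphism fixing the C_i^{±1} and the B_j (j ≠ n) and sending B_n^σ to B_n^{σ+2k}. -/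
namespace QG

/-- Generators of the quantized universal enveloping algebra `U_q(gl(m))`:
`K i`, its inverse `Ki i`, and the Chevalley generators `E j` (the `x_j`)
and `F j` (the `y_j`).  Indices are 1-based natural numbers; out-of-range
generators are forced to be `1` (resp. `0`) by the relations. -/
inductive Gen : Type where
  | K : ℕ → Gen
  | Ki : ℕ → Gen
  | E : ℕ → Gen
  | F : ℕ → Gen

abbrev FA := FreeAlgebra ℂ Gen

noncomputable def fK (i : ℕ) : FA := FreeAlgebra.ι ℂ (Gen.K i)
noncomputable def fKi (i : ℕ) : FA := FreeAlgebra.ι ℂ (Gen.Ki i)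
noncomputable def fE (i : ℕ) : FA := FreeAlgebra.ι ℂ (Gen.E i)
noncomputable def fF (i : ℕ) : FA := FreeAlgebra.ι ℂ (Gen.F i)

/-- Kronecker delta with values in `ℤ`. -/
def kd (i j : ℕ) : ℤ := if i = j then 1 else 0

/-- The defining relations of `U_q(gl(m))`. -/
inductive Rel (q : ℝ) (m : ℕ) : FA → FA → Prop
  | Kout : ∀ i, ¬(1 ≤ i ∧ i ≤ m) → Rel q m (fK i) 1
  | Kiout : ∀ i, ¬(1 ≤ i ∧ i ≤ m) → Rel q m (fKi i) 1
  | Eout : ∀ j, ¬(1 ≤ j ∧ j + 1 ≤ m) → Rel q m (fE j) 0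
  | Fout : ∀ j, ¬(1 ≤ j ∧ j + 1 ≤ m) → Rel q m (fF j) 0
  | KK : ∀ i j, Rel q m (fK i * fK j) (fK j * fK i)
  | KKi : ∀ i, Rel q m (fK i * fKi i) 1
  | KiK : ∀ i, Rel q m (fKi i * fK i) 1
  | KE : ∀ i j, 1 ≤ i → i ≤ m → 1 ≤ j → j + 1 ≤ m →
      Rel q m (fK i * fE j) (((q : ℂ) ^ (kd i j - kd i (j+1))) • (fE j * fK i))
  | KF : ∀ i j, 1 ≤ i → i ≤ m → 1 ≤ j → j + 1 ≤ m →
      Rel q m (fK i * fF j) (((q : ℂ) ^ (kd i (j+1) - kd i j)) • (fF j * fK i))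
  | EF : ∀ i j, 1 ≤ i → i + 1 ≤ m → 1 ≤ j → j + 1 ≤ m →
      Rel q m (fE i * fF j - fF j * fE i)
        (if i = j then ((q : ℂ) - (q : ℂ)⁻¹)⁻¹ • (fK i * fKi (i+1) - fKi i * fK (i+1)) else 0)
  | EE : ∀ i j, 1 ≤ i → i + 1 ≤ m → 1 ≤ j → j + 1 ≤ m → (i + 2 ≤ j ∨ j + 2 ≤ i) →
      Rel q m (fE i * fE j) (fE j * fE i)
  | FF : ∀ i j, 1 ≤ i → i + 1 ≤ m → 1 ≤ j → j + 1 ≤ m → (i + 2 ≤ j ∨ j + 2 ≤ i) →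
      Rel q m (fF i * fF j) (fF j * fF i)
  | Eserre : ∀ i j, 1 ≤ i → i + 1 ≤ m → 1 ≤ j → j + 1 ≤ m → (i + 1 = j ∨ j + 1 = i) →
      Rel q m (fE i ^ 2 * fE j - ((q : ℂ) + (q : ℂ)⁻¹) • (fE i * fE j * fE i) + fE j * fE i ^ 2) 0
  | Fserre : ∀ i j, 1 ≤ i → i + 1 ≤ m → 1 ≤ j → j + 1 ≤ m → (i + 1 = j ∨ j + 1 = i) →
      Rel q m (fF i ^ 2 * fF j - ((q : ℂ) + (q : ℂ)⁻¹) • (fF i * fF j * fF i) + fF j * fF i ^ 2) 0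

/-- The quantized universal enveloping algebra `U_q(gl(m))`. -/
abbrev Uq (q : ℝ) (m : ℕ) := RingQuot (Rel q m)

noncomputable def uK (q : ℝ) (m i : ℕ) : Uq q m := RingQuot.mkAlgHom ℂ (Rel q m) (fK i)
noncomputable def uKi (q : ℝ) (m i : ℕ) : Uq q m := RingQuot.mkAlgHom ℂ (Rel q m) (fKi i)
noncomputable def uE (q : ℝ) (m i : ℕ) : Uq q m := RingQuot.mkAlgHom ℂ (Rel q m) (fE i)
noncomputable def uF (q : ℝ) (m i : ℕ) : Uq q m := RingQuot.mkAlgHom ℂ (Rel q m) (fF i)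

/-- `C_i = K_i K_{2n+1-i}` in `U_q(gl(2n))`. -/
noncomputable def Cc (q : ℝ) (n i : ℕ) : Uq q (2*n) := uK q (2*n) i * uK q (2*n) (2*n+1-i)
/-- `C_i⁻¹ = K_i⁻¹ K_{2n+1-i}⁻¹` in `U_q(gl(2n))`. -/
noncomputable def Ccinv (q : ℝ) (n i : ℕ) : Uq q (2*n) := uKi q (2*n) i * uKi q (2*n) (2*n+1-i)
/-- `B_j = y_j K_{j+1}⁻¹ K_{2n-j}⁻¹ + K_j⁻¹ x_{2n-j} K_{2n-j}⁻¹` in `U_q(gl(2n))`. -/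
noncomputable def Bb (q : ℝ) (n j : ℕ) : Uq q (2*n) :=
  uF q (2*n) j * uKi q (2*n) (j+1) * uKi q (2*n) (2*n-j)
  + uKi q (2*n) j * uE q (2*n) (2*n-j) * uKi q (2*n) (2*n-j)
/-- `B_n^σ = y_n K_{n+1}⁻¹ K_n⁻¹ + K_n⁻¹ x_n K_n⁻¹ + ((q^{-σ}-q^{σ})/(q-q⁻¹)) K_n⁻²`. -/
noncomputable def Bs (q σ : ℝ) (n : ℕ) : Uq q (2*n) :=
  uF q (2*n) n * uKi q (2*n) (n+1) * uKi q (2*n) n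
  + uKi q (2*n) n * uE q (2*n) n * uKi q (2*n) n
  + (((q ^ (-σ) - q ^ σ) / (q - q⁻¹) : ℝ) : ℂ) • ((uKi q (2*n) n)^2)

/-- The generating set of the coideal subalgebra `𝒜_σ ⊆ U_q(gl(2n))`. -/
def ASet (q σ : ℝ) (n : ℕ) : Set (Uq q (2*n)) :=
  {z | (∃ i, 1 ≤ i ∧ i ≤ 2*n ∧ (z = Cc q n i ∨ z = Ccinv q n i)) ∨
       (∃ j, 1 ≤ j ∧ j + 1 ≤ 2*n ∧ j ≠ n ∧ z = Bb q n j) ∨ z = Bs q σ n}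

/-- Generators of the abstract algebra `𝒜`. -/
inductive AGen : Type where
  | g : ℕ → AGen
  | gi : ℕ → AGen
  | b : ℕ → AGen

abbrev AFA := FreeAlgebra ℂ AGen

noncomputable def fγ (i : ℕ) : AFA := FreeAlgebra.ι ℂ (AGen.g i)
noncomputable def fγi (i : ℕ) : AFA := FreeAlgebra.ι ℂ (AGen.gi i)
noncomputable def fβ (j : ℕ) : AFA := FreeAlgebra.ι ℂ (AGen.b j)

/-- `(ε_i + ε_{2n+1-i}, α_j)` where `α_j = ε_j - ε_{j+1}`. -/
def gex (n i j : ℕ) : ℤ := kd i j + kd (2*n+1-i) j - kd i (j+1) - kd (2*n+1-i) (j+1)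

/-- The defining relations of the algebra `𝒜`. -/
inductive ARel (q : ℝ) (n : ℕ) : AFA → AFA → Prop
  | gout : ∀ i, ¬(1 ≤ i ∧ i ≤ 2*n) → ARel q n (fγ i) 1
  | giout : ∀ i, ¬(1 ≤ i ∧ i ≤ 2*n) → ARel q n (fγi i) 1
  | bout : ∀ j, ¬(1 ≤ j ∧ j + 1 ≤ 2*n) → ARel q n (fβ j) 0
  | gg : ∀ i j, ARel q n (fγ i * fγ j) (fγ j * fγ i)
  | ggi : ∀ i, ARel q n (fγ i * fγi i) 1
  | gig : ∀ i, ARel q n (fγi i * fγ i) 1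
  | gsym : ∀ i, 1 ≤ i → i ≤ 2*n → ARel q n (fγ i) (fγ (2*n+1-i))
  | gb : ∀ i j, 1 ≤ i → i ≤ 2*n → 1 ≤ j → j + 1 ≤ 2*n →
      ARel q n (fγ i * fβ j) (((q : ℂ) ^ (-(gex n i j))) • (fβ j * fγ i))
  | bb : ∀ i j, 1 ≤ i → i + 1 ≤ 2*n → 1 ≤ j → j + 1 ≤ 2*n → (i + 2 ≤ j ∨ j + 2 ≤ i) →
      ARel q n (fβ i * fβ j - fβ j * fβ i)
        (if i + j = 2*n then ((q : ℂ) * ((q : ℂ) - (q : ℂ)⁻¹)⁻¹) • (fγi i ^ 2 - fγi (i+1) ^ 2)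
         else 0)
  | serre1 : ∀ i, 1 ≤ i → i + 2 ≤ 2*n →
      ARel q n
        ((q : ℂ)⁻¹ • (fβ i ^ 2 * fβ (i+1)) - ((q : ℂ) + (q : ℂ)⁻¹) • (fβ i * fβ (i+1) * fβ i)
          + (q : ℂ) • (fβ (i+1) * fβ i ^ 2))
        (if i = n then (q : ℂ) • (fβ (n+1) * fγi n ^ 2) else 0)
  | serre2 : ∀ i, 2 ≤ i → i + 1 ≤ 2*n →
      ARel q n
        ((q : ℂ) • (fβ i ^ 2 * fβ (i-1)) - ((q : ℂ) + (q : ℂ)⁻¹) • (fβ i * fβ (i-1) * fβ i)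
          + (q : ℂ)⁻¹ • (fβ (i-1) * fβ i ^ 2))
        (if i = n then (q : ℂ)⁻¹ • (fβ (n-1) * fγi n ^ 2) else 0)

/-- The abstract algebra `𝒜`. -/
abbrev Aalg (q : ℝ) (n : ℕ) := RingQuot (ARel q n)

noncomputable def aγ (q : ℝ) (n i : ℕ) : Aalg q n := RingQuot.mkAlgHom ℂ (ARel q n) (fγ i)
noncomputable def aγi (q : ℝ) (n i : ℕ) : Aalg q n := RingQuot.mkAlgHom ℂ (ARel q n) (fγi i)
noncomputable def aβ (q : ℝ) (n j : ℕ) : Aalg q n := RingQuot.mkAlgHom ℂ (ARel q n) (fβ j)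


/-! ### Relations in `U_q(gl(m))` -/

open scoped TensorProduct

section Uq

variable {q : ℝ} {m : ℕ}

lemma uK_comm (i j : ℕ) : uK q m i * uK q m j = uK q m j * uK q m i := by
  simpa [uK] using RingQuot.mkAlgHom_rel ℂ (Rel.KK (q := q) (m := m) i j)

lemma uK_mul_uKi (i : ℕ) : uK q m i * uKi q m i = 1 := by
  simpa [uK, uKi] using RingQuot.mkAlgHom_rel ℂ (Rel.KKi (q := q) (m := m) i)

lemma uKi_mul_uK (i : ℕ) : uKi q m i * uK q m i = 1 := by
  simpa [uK, uKi] using RingQuot.mkAlgHom_rel ℂ (Rel.KiK (q := q) (m := m) i)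

lemma uK_of_not {i : ℕ} (h : ¬(1 ≤ i ∧ i ≤ m)) : uK q m i = 1 := by
  simpa [uK] using RingQuot.mkAlgHom_rel ℂ (Rel.Kout (q := q) i h)

lemma uKi_of_not {i : ℕ} (h : ¬(1 ≤ i ∧ i ≤ m)) : uKi q m i = 1 := by
  simpa [uKi] using RingQuot.mkAlgHom_rel ℂ (Rel.Kiout (q := q) i h)

lemma uE_of_not {i : ℕ} (h : ¬(1 ≤ i ∧ i + 1 ≤ m)) : uE q m i = 0 := by
  simpa [uE] using RingQuot.mkAlgHom_rel ℂ (Rel.Eout (q := q) i h)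

lemma uF_of_not {i : ℕ} (h : ¬(1 ≤ i ∧ i + 1 ≤ m)) : uF q m i = 0 := by
  simpa [uF] using RingQuot.mkAlgHom_rel ℂ (Rel.Fout (q := q) i h)

lemma uK_mul_uE {i j : ℕ} (hi : 1 ≤ i) (hi' : i ≤ m) (hj : 1 ≤ j) (hj' : j + 1 ≤ m) :
    uK q m i * uE q m j = (q : ℂ) ^ (kd i j - kd i (j + 1)) • (uE q m j * uK q m i) := by
  simpa only [uK, uE, map_mul, map_smul] using
    RingQuot.mkAlgHom_rel ℂ (Rel.KE (q := q) i j hi hi' hj hj')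

lemma uK_mul_uF {i j : ℕ} (hi : 1 ≤ i) (hi' : i ≤ m) (hj : 1 ≤ j) (hj' : j + 1 ≤ m) :
    uK q m i * uF q m j = (q : ℂ) ^ (kd i (j + 1) - kd i j) • (uF q m j * uK q m i) := by
  simpa only [uK, uF, map_mul, map_smul] using
    RingQuot.mkAlgHom_rel ℂ (Rel.KF (q := q) i j hi hi' hj hj')

lemma uE_mul_uF {i j : ℕ} (hi : 1 ≤ i) (hi' : i + 1 ≤ m) (hj : 1 ≤ j) (hj' : j + 1 ≤ m) :
    uE q m i * uF q m j - uF q m j * uE q m i =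
      if i = j then ((q : ℂ) - (q : ℂ)⁻¹)⁻¹ •
        (uK q m i * uKi q m (i + 1) - uKi q m i * uK q m (i + 1)) else 0 := by
  have h := RingQuot.mkAlgHom_rel ℂ (Rel.EF (q := q) i j hi hi' hj hj')
  split_ifs at h ⊢ <;>
  simpa only [uK, uKi, uE, uF, map_mul, map_smul, map_sub, map_zero] using h

lemma uE_comm {i j : ℕ} (hi : 1 ≤ i) (hi' : i + 1 ≤ m) (hj : 1 ≤ j) (hj' : j + 1 ≤ m)
    (h : i + 2 ≤ j ∨ j + 2 ≤ i) : uE q m i * uE q m j = uE q m j * uE q m i := by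
  simpa only [uE, map_mul] using RingQuot.mkAlgHom_rel ℂ (Rel.EE (q := q) i j hi hi' hj hj' h)

lemma uF_comm {i j : ℕ} (hi : 1 ≤ i) (hi' : i + 1 ≤ m) (hj : 1 ≤ j) (hj' : j + 1 ≤ m)
    (h : i + 2 ≤ j ∨ j + 2 ≤ i) : uF q m i * uF q m j = uF q m j * uF q m i := by
  simpa only [uF, map_mul] using RingQuot.mkAlgHom_rel ℂ (Rel.FF (q := q) i j hi hi' hj hj' h)

lemma uE_serre {i j : ℕ} (hi : 1 ≤ i) (hi' : i + 1 ≤ m) (hj : 1 ≤ j) (hj' : j + 1 ≤ m)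
    (h : i + 1 = j ∨ j + 1 = i) :
    uE q m i ^ 2 * uE q m j - ((q : ℂ) + (q : ℂ)⁻¹) • (uE q m i * uE q m j * uE q m i)
      + uE q m j * uE q m i ^ 2 = 0 := by
  simpa only [uE, map_mul, map_add, map_sub, map_smul, map_pow, map_zero] using
    RingQuot.mkAlgHom_rel ℂ (Rel.Eserre (q := q) i j hi hi' hj hj' h)

lemma uF_serre {i j : ℕ} (hi : 1 ≤ i) (hi' : i + 1 ≤ m) (hj : 1 ≤ j) (hj' : j + 1 ≤ m)
    (h : i + 1 = j ∨ j + 1 = i) :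
    uF q m i ^ 2 * uF q m j - ((q : ℂ) + (q : ℂ)⁻¹) • (uF q m i * uF q m j * uF q m i)
      + uF q m j * uF q m i ^ 2 = 0 := by
  simpa only [uF, map_mul, map_add, map_sub, map_smul, map_pow, map_zero] using
    RingQuot.mkAlgHom_rel ℂ (Rel.Fserre (q := q) i j hi hi' hj hj' h)

lemma uK_commute (i j : ℕ) : Commute (uK q m i) (uK q m j) := uK_comm i j

/-- Left and right inverses of commuting elements commute. -/
lemma commute_of_inverse {R : Type*} [Monoid R] {a b c : R} (h : Commute a c)
    (hab : a * b = 1) (hba : b * a = 1) : Commute b c :=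
  calc b * c = b * c * (a * b) := by rw [hab, mul_one]
    _ = b * (c * a) * b := by simp only [mul_assoc]
    _ = b * (a * c) * b := by rw [h.eq]
    _ = b * a * (c * b) := by simp only [mul_assoc]
    _ = c * b := by rw [hba, one_mul]

lemma uKi_commute_uK (i j : ℕ) : Commute (uKi q m i) (uK q m j) :=
  commute_of_inverse (uK_commute i j) (uK_mul_uKi i) (uKi_mul_uK i)

lemma uKi_commute (i j : ℕ) : Commute (uKi q m i) (uKi q m j) :=
  commute_of_inverse (uKi_commute_uK j i).symm (uK_mul_uKi i) (uKi_mul_uK i)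

/-- An inverse of a `t`-commuting element `t⁻¹`-commutes. -/
lemma inverse_mul_of_mul_eq_smul {R : Type*} [Ring R] [Algebra ℂ R] {a b c : R} {t : ℂ}
    (ht : t ≠ 0) (h : a * c = t • (c * a)) (hab : a * b = 1) (hba : b * a = 1) :
    b * c = t⁻¹ • (c * b) := by
  have : c * b = t • (b * c) :=
    calc c * b = b * (a * c) * b := by rw [← mul_assoc, hba, one_mul]
      _ = t • (b * c) := by
        rw [h, mul_smul_comm, smul_mul_assoc, mul_assoc, mul_assoc, hab, mul_one]
  rw [this, smul_smul, inv_mul_cancel₀ ht, one_smul]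

/-- The Cartan matrix of `gl(m)`. -/
def cartan (i j : ℕ) : ℤ := kd i j - kd i (j + 1) - (kd (i + 1) j - kd (i + 1) (j + 1))

/-- The group-like element `K_i K_{i+1}⁻¹`. -/
noncomputable def kk (q : ℝ) (m i : ℕ) : Uq q m := uK q m i * uKi q m (i + 1)

/-- The group-like element `K_i⁻¹ K_{i+1}`. -/
noncomputable def kki (q : ℝ) (m i : ℕ) : Uq q m := uKi q m i * uK q m (i + 1)

lemma kk_mul_kki (i : ℕ) : kk q m i * kki q m i = 1 := by
  rw [kk, kki, mul_assoc, ← mul_assoc (uKi q m (i + 1)), (uKi_commute (i + 1) i).eq, mul_assoc,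
    uKi_mul_uK, mul_one, uK_mul_uKi]

lemma kki_mul_kk (i : ℕ) : kki q m i * kk q m i = 1 := by
  rw [kk, kki, mul_assoc, ← mul_assoc (uK q m (i + 1)), uK_comm (i + 1) i, mul_assoc,
    uK_mul_uKi, mul_one, uKi_mul_uK]

lemma uK_commute_kk (i j : ℕ) : Commute (uK q m i) (kk q m j) :=
  (uK_commute i j).mul_right (uKi_commute_uK (j + 1) i).symm

lemma uK_commute_kki (i j : ℕ) : Commute (uK q m i) (kki q m j) :=
  (uKi_commute_uK j i).symm.mul_right (uK_commute i (j + 1))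

lemma kk_commute (i j : ℕ) : Commute (kk q m i) (kk q m j) :=
  (uK_commute_kk i j).mul_left
    ((uKi_commute_uK (i + 1) j).mul_right (uKi_commute (i + 1) (j + 1)))

lemma kki_commute (i j : ℕ) : Commute (kki q m i) (kki q m j) :=
  ((uKi_commute i j).mul_right (uKi_commute_uK i (j + 1))).mul_left (uK_commute_kki (i + 1) j)

lemma kk_mul_uE (hq : (q : ℂ) ≠ 0) {i j : ℕ} (hi : 1 ≤ i) (hi' : i + 1 ≤ m) (hj : 1 ≤ j)
    (hj' : j + 1 ≤ m) : kk q m i * uE q m j = (q : ℂ) ^ cartan i j • (uE q m j * kk q m i) := by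
  rw [kk, mul_assoc, inverse_mul_of_mul_eq_smul (zpow_ne_zero _ hq)
    (uK_mul_uE (by omega) hi' hj hj') (uK_mul_uKi _) (uKi_mul_uK _), mul_smul_comm, ← mul_assoc,
    uK_mul_uE hi (by omega) hj hj', smul_mul_assoc, smul_smul, mul_assoc, ← zpow_neg,
    ← zpow_add₀ hq]
  congr 2
  rw [cartan]; ring

lemma kk_mul_uF (hq : (q : ℂ) ≠ 0) {i j : ℕ} (hi : 1 ≤ i) (hi' : i + 1 ≤ m) (hj : 1 ≤ j)
    (hj' : j + 1 ≤ m) :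
    kk q m i * uF q m j = ((q : ℂ) ^ cartan i j)⁻¹ • (uF q m j * kk q m i) := by
  rw [kk, mul_assoc, inverse_mul_of_mul_eq_smul (zpow_ne_zero _ hq)
    (uK_mul_uF (by omega) hi' hj hj') (uK_mul_uKi _) (uKi_mul_uK _), mul_smul_comm, ← mul_assoc,
    uK_mul_uF hi (by omega) hj hj', smul_mul_assoc, smul_smul, mul_assoc, ← zpow_neg,
    ← zpow_neg, ← zpow_add₀ hq]
  congr 2
  rw [cartan]; ring

lemma kki_mul_uE (hq : (q : ℂ) ≠ 0) {i j : ℕ} (hi : 1 ≤ i) (hi' : i + 1 ≤ m) (hj : 1 ≤ j)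
    (hj' : j + 1 ≤ m) :
    kki q m i * uE q m j = ((q : ℂ) ^ cartan i j)⁻¹ • (uE q m j * kki q m i) :=
  inverse_mul_of_mul_eq_smul (zpow_ne_zero _ hq) (kk_mul_uE hq hi hi' hj hj') (kk_mul_kki i)
    (kki_mul_kk i)

lemma kki_mul_uF (hq : (q : ℂ) ≠ 0) {i j : ℕ} (hi : 1 ≤ i) (hi' : i + 1 ≤ m) (hj : 1 ≤ j)
    (hj' : j + 1 ≤ m) :
    kki q m i * uF q m j = (q : ℂ) ^ cartan i j • (uF q m j * kki q m i) := by
  simpa using inverse_mul_of_mul_eq_smul (inv_ne_zero (zpow_ne_zero _ hq))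
    (kk_mul_uF hq hi hi' hj hj') (kk_mul_kki i) (kki_mul_kk i)

lemma cartan_symm (i j : ℕ) : cartan i j = cartan j i := by
  simp only [cartan, kd]; split_ifs <;> omega

lemma cartan_self (i : ℕ) : cartan i i = 2 := by
  simp only [cartan, kd]; split_ifs <;> omega

lemma cartan_adjacent {i j : ℕ} (h : i + 1 = j ∨ j + 1 = i) : cartan i j = -1 := by
  simp only [cartan, kd]; split_ifs <;> omega

lemma cartan_distant {i j : ℕ} (h : i + 2 ≤ j ∨ j + 2 ≤ i) : cartan i j = 0 := by
  simp only [cartan, kd]; split_ifs <;> omega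

/-- The quantum Serre relation is inherited by sums of suitably `q`-commuting solutions. -/
lemma serre_add {R : Type*} [Ring R] [Algebra ℂ R] {t : ℂ} (ht : t ≠ 0) {a₁ a₂ b₁ b₂ : R}
    (ha : a₁ ^ 2 * a₂ - (t + t⁻¹) • (a₁ * a₂ * a₁) + a₂ * a₁ ^ 2 = 0)
    (hb : b₁ ^ 2 * b₂ - (t + t⁻¹) • (b₁ * b₂ * b₁) + b₂ * b₁ ^ 2 = 0)
    (h₁₁ : b₁ * a₁ = (t ^ 2) • (a₁ * b₁)) (h₁₂ : b₁ * a₂ = t⁻¹ • (a₂ * b₁))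
    (h₂₁ : b₂ * a₁ = t⁻¹ • (a₁ * b₂)) :
    (a₁ + b₁) ^ 2 * (a₂ + b₂) - (t + t⁻¹) • ((a₁ + b₁) * (a₂ + b₂) * (a₁ + b₁))
      + (a₂ + b₂) * (a₁ + b₁) ^ 2 = 0 := by
  have ha' : a₁ * (a₁ * a₂) = (t + t⁻¹) • (a₁ * (a₂ * a₁)) - a₂ * (a₁ * a₁) := by
    rw [← sub_eq_zero, ← ha]; simp only [pow_two, mul_assoc]; abel
  have hb' : b₁ * (b₁ * b₂) = (t + t⁻¹) • (b₁ * (b₂ * b₁)) - b₂ * (b₁ * b₁) := by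
    rw [← sub_eq_zero, ← hb]; simp only [pow_two, mul_assoc]; abel
  have g₁₁ (x : R) : b₁ * (a₁ * x) = (t ^ 2) • (a₁ * (b₁ * x)) := by
    rw [← mul_assoc, h₁₁, smul_mul_assoc, mul_assoc]
  have g₁₂ (x : R) : b₁ * (a₂ * x) = t⁻¹ • (a₂ * (b₁ * x)) := by
    rw [← mul_assoc, h₁₂, smul_mul_assoc, mul_assoc]
  have g₂₁ (x : R) : b₂ * (a₁ * x) = t⁻¹ • (a₁ * (b₂ * x)) := by
    rw [← mul_assoc, h₂₁, smul_mul_assoc, mul_assoc]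
  simp only [pow_two, mul_assoc, mul_add, add_mul, ha', hb', g₁₁, g₁₂, g₂₁, h₁₁, h₁₂, h₂₁,
    mul_smul_comm, smul_mul_assoc, mul_assoc, smul_smul, smul_add]
  match_scalars <;> field_simp <;> ring


/-! ### The coproduct of `U_q(gl(m))` -/

/-- Values of the coproduct on generators. -/
noncomputable def comulGen (q : ℝ) (m : ℕ) : Gen → Uq q m ⊗[ℂ] Uq q m
  | .K i => uK q m i ⊗ₜ uK q m i
  | .Ki i => uKi q m i ⊗ₜ uKi q m i
  | .E i => uE q m i ⊗ₜ 1 + kk q m i ⊗ₜ uE q m i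
  | .F i => 1 ⊗ₜ uF q m i + uF q m i ⊗ₜ kki q m i

lemma tmul_kk_mul_kk (i : ℕ) : (uK q m i ⊗ₜ[ℂ] uK q m i) * (uKi q m (i + 1) ⊗ₜ uKi q m (i + 1)) =
    kk q m i ⊗ₜ kk q m i := by
  rw [Algebra.TensorProduct.tmul_mul_tmul]; rfl

lemma tmul_kki_mul_kki (i : ℕ) :
    (uKi q m i ⊗ₜ[ℂ] uKi q m i) * (uK q m (i + 1) ⊗ₜ uK q m (i + 1)) =
    kki q m i ⊗ₜ kki q m i := by
  rw [Algebra.TensorProduct.tmul_mul_tmul]; rfl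

lemma comulGen_rel (hq : (q : ℂ) ≠ 0) ⦃x y : FA⦄ (h : Rel q m x y) :
    FreeAlgebra.lift ℂ (comulGen q m) x = FreeAlgebra.lift ℂ (comulGen q m) y := by
  cases h with
  | Kout i h => simp [fK, comulGen, uK_of_not h, Algebra.TensorProduct.one_def]
  | Kiout i h => simp [fKi, comulGen, uKi_of_not h, Algebra.TensorProduct.one_def]
  | Eout i h => simp [fE, comulGen, uE_of_not h]
  | Fout i h => simp [fF, comulGen, uF_of_not h]
  | KK i j => simp [fK, comulGen, uK_comm i j]
  | KKi i => simp [fK, fKi, comulGen, uK_mul_uKi, Algebra.TensorProduct.one_def]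
  | KiK i => simp [fK, fKi, comulGen, uKi_mul_uK, Algebra.TensorProduct.one_def]
  | KE i j hi hi' hj hj' =>
    simp [fK, fE, comulGen, mul_add, add_mul, uK_mul_uE hi hi' hj hj', (uK_commute_kk i j).eq,
      TensorProduct.smul_tmul']
  | KF i j hi hi' hj hj' =>
    simp [fK, fF, comulGen, mul_add, add_mul, uK_mul_uF hi hi' hj hj', (uK_commute_kki i j).eq,
      TensorProduct.smul_tmul']
  | EE i j hi hi' hj hj' h =>
    have h₁ := kk_mul_uE hq hi hi' hj hj'
    have h₂ := kk_mul_uE hq hj hj' hi hi'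
    rw [cartan_distant h, zpow_zero, one_smul] at h₁
    rw [cartan_distant h.symm, zpow_zero, one_smul] at h₂
    simp only [fE, comulGen, map_mul, FreeAlgebra.lift_ι_apply, mul_add, add_mul,
      Algebra.TensorProduct.tmul_mul_tmul, one_mul, mul_one, h₁, h₂, uE_comm hi hi' hj hj' h,
      (kk_commute i j).eq]
    abel
  | FF i j hi hi' hj hj' h =>
    have h₁ := kki_mul_uF hq hi hi' hj hj'
    have h₂ := kki_mul_uF hq hj hj' hi hi'
    rw [cartan_distant h, zpow_zero, one_smul] at h₁
    rw [cartan_distant h.symm, zpow_zero, one_smul] at h₂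
    simp only [fF, comulGen, map_mul, FreeAlgebra.lift_ι_apply, mul_add, add_mul,
      Algebra.TensorProduct.tmul_mul_tmul, one_mul, mul_one, h₁, h₂, uF_comm hi hi' hj hj' h,
      (kki_commute i j).eq]
    abel
  | Eserre i j hi hi' hj hj' h =>
    simp only [fE, comulGen, map_mul, map_add, map_sub, map_smul, map_pow, map_zero,
      FreeAlgebra.lift_ι_apply]
    refine serre_add (R := Uq q m ⊗[ℂ] Uq q m) hq ?_ ?_ ?_ ?_ ?_
    · simp only [pow_two, Algebra.TensorProduct.tmul_mul_tmul, TensorProduct.smul_tmul',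
        ← TensorProduct.sub_tmul, ← TensorProduct.add_tmul, mul_one]
      rw [← pow_two, uE_serre hi hi' hj hj' h, TensorProduct.zero_tmul]
    · simp only [pow_two, Algebra.TensorProduct.tmul_mul_tmul]
      rw [(kk_commute j i).left_comm, mul_assoc (kk q m i) (kk q m j), (kk_commute j i).eq,
        ← TensorProduct.tmul_smul, mul_assoc (kk q m i), ← TensorProduct.tmul_sub,
        ← TensorProduct.tmul_add, ← pow_two, uE_serre hi hi' hj hj' h, TensorProduct.tmul_zero]
    · simp only [Algebra.TensorProduct.tmul_mul_tmul, one_mul, mul_one,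
        kk_mul_uE hq hi hi' hi hi', cartan_self, TensorProduct.smul_tmul']
      norm_cast
    · simp only [Algebra.TensorProduct.tmul_mul_tmul, one_mul, mul_one,
        kk_mul_uE hq hi hi' hj hj', cartan_adjacent h, TensorProduct.smul_tmul', zpow_neg_one]
    · simp only [Algebra.TensorProduct.tmul_mul_tmul, one_mul, mul_one,
        kk_mul_uE hq hj hj' hi hi', cartan_adjacent h.symm, TensorProduct.smul_tmul', zpow_neg_one]
  | Fserre i j hi hi' hj hj' h =>
    simp only [fF, comulGen, map_mul, map_add, map_sub, map_smul, map_pow, map_zero,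
      FreeAlgebra.lift_ι_apply]
    refine serre_add (R := Uq q m ⊗[ℂ] Uq q m) hq ?_ ?_ ?_ ?_ ?_
    · simp only [pow_two, Algebra.TensorProduct.tmul_mul_tmul, ← TensorProduct.tmul_smul,
        ← TensorProduct.tmul_sub, ← TensorProduct.tmul_add, mul_one]
      rw [← pow_two, uF_serre hi hi' hj hj' h, TensorProduct.tmul_zero]
    · simp only [pow_two, Algebra.TensorProduct.tmul_mul_tmul]
      rw [(kki_commute j i).left_comm, mul_assoc (kki q m i) (kki q m j), (kki_commute j i).eq,
        TensorProduct.smul_tmul', mul_assoc (kki q m i), ← TensorProduct.sub_tmul,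
        ← TensorProduct.add_tmul, ← pow_two, uF_serre hi hi' hj hj' h, TensorProduct.zero_tmul]
    · simp only [Algebra.TensorProduct.tmul_mul_tmul, one_mul, mul_one,
        kki_mul_uF hq hi hi' hi hi', cartan_self, TensorProduct.tmul_smul]
      norm_cast
    · simp only [Algebra.TensorProduct.tmul_mul_tmul, one_mul, mul_one,
        kki_mul_uF hq hi hi' hj hj', cartan_adjacent h, TensorProduct.tmul_smul, zpow_neg_one]
    · simp only [Algebra.TensorProduct.tmul_mul_tmul, one_mul, mul_one,
        kki_mul_uF hq hj hj' hi hi', cartan_adjacent h.symm, TensorProduct.tmul_smul, zpow_neg_one]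
  | EF i j hi hi' hj hj' =>
    have key : (uE q m i ⊗ₜ[ℂ] 1 + kk q m i ⊗ₜ uE q m i) * (1 ⊗ₜ uF q m j + uF q m j ⊗ₜ kki q m j)
        - (1 ⊗ₜ uF q m j + uF q m j ⊗ₜ kki q m j) * (uE q m i ⊗ₜ 1 + kk q m i ⊗ₜ uE q m i)
        = (uE q m i * uF q m j - uF q m j * uE q m i) ⊗ₜ kki q m j
          + kk q m i ⊗ₜ (uE q m i * uF q m j - uF q m j * uE q m i) := by
      simp only [mul_add, add_mul, Algebra.TensorProduct.tmul_mul_tmul, one_mul, mul_one,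
        kk_mul_uF hq hi hi' hj hj', kki_mul_uE hq hj hj' hi hi', cartan_symm j i,
        TensorProduct.tmul_smul, TensorProduct.smul_tmul', TensorProduct.sub_tmul,
        TensorProduct.tmul_sub]
      abel
    rw [apply_ite (FreeAlgebra.lift ℂ (comulGen q m))]
    simp only [fE, fF, fK, fKi, comulGen, map_mul, map_sub, map_smul, map_zero,
      FreeAlgebra.lift_ι_apply, tmul_kk_mul_kk, tmul_kki_mul_kki]
    rw [key, uE_mul_uF hi hi' hj hj']
    split_ifs with hij
    · subst hij
      change (((q : ℂ) - (q : ℂ)⁻¹)⁻¹ • (kk q m i - kki q m i)) ⊗ₜ[ℂ] kki q m i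
        + kk q m i ⊗ₜ[ℂ] (((q : ℂ) - (q : ℂ)⁻¹)⁻¹ • (kk q m i - kki q m i)) = _
      rw [TensorProduct.tmul_smul, ← TensorProduct.smul_tmul', ← smul_add, TensorProduct.sub_tmul,
        TensorProduct.tmul_sub]
      congr 1
      abel
    · simp

/-- The coproduct of `U_q(gl(m))`. -/
noncomputable def comul (hq : (q : ℂ) ≠ 0) : Uq q m →ₐ[ℂ] Uq q m ⊗[ℂ] Uq q m :=
  RingQuot.liftAlgHom ℂ ⟨FreeAlgebra.lift ℂ (comulGen q m), comulGen_rel hq⟩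

@[simp] lemma comul_uK (hq : (q : ℂ) ≠ 0) (i : ℕ) :
    comul hq (uK q m i) = uK q m i ⊗ₜ uK q m i := by simp [comul, uK, fK, comulGen]

@[simp] lemma comul_uKi (hq : (q : ℂ) ≠ 0) (i : ℕ) :
    comul hq (uKi q m i) = uKi q m i ⊗ₜ uKi q m i := by simp [comul, uKi, fKi, comulGen]

@[simp] lemma comul_uE (hq : (q : ℂ) ≠ 0) (i : ℕ) :
    comul hq (uE q m i) = uE q m i ⊗ₜ 1 + kk q m i ⊗ₜ uE q m i := by simp [comul, uE, fE, comulGen]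

@[simp] lemma comul_uF (hq : (q : ℂ) ≠ 0) (i : ℕ) :
    comul hq (uF q m i) = 1 ⊗ₜ uF q m i + uF q m i ⊗ₜ kki q m i := by
  simp [comul, uF, fF, comulGen]

end Uq

/-! ### The fermionic Fock representation of `U_q(gl(m))` -/

section Fock

/-- The occupation pattern `s` with the occupations of the sites `i`, `i + 1` replaced. -/
def setPair (i : ℕ) (a b : Bool) (s : ℕ → Bool) (k : ℕ) : Bool :=
  if k = i then a else if k = i + 1 then b else s k

/-- The diagonal operator of `K_i`, and of its inverse after exchanging `h` and `h'`. -/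
def fockK (m : ℕ) (h h' : ℂ) (i : ℕ) : Module.End ℂ ((ℕ → Bool) → ℂ) where
  toFun f s := (if 1 ≤ i ∧ i ≤ m then (if s i then h else h') else 1) * f s
  map_add' f g := by ext s; simp [mul_add]
  map_smul' c f := by ext s; simp only [Pi.smul_apply, smul_eq_mul, RingHom.id_apply]; ring

/-- The operator moving a particle between the sites `i` and `i + 1`; the patterns it produces
have occupation `a` at `i` and `!a` at `i + 1`. -/
def fockMove (m : ℕ) (a : Bool) (i : ℕ) : Module.End ℂ ((ℕ → Bool) → ℂ) where
  toFun f s :=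
    if (1 ≤ i ∧ i + 1 ≤ m) ∧ s i = a ∧ s (i + 1) = !a then f (setPair i (!a) a s) else 0
  map_add' f g := by ext s; simp only [Pi.add_apply]; split_ifs <;> simp
  map_smul' c f := by
    ext s; simp only [Pi.smul_apply, smul_eq_mul, RingHom.id_apply]; split_ifs <;> simp

variable {m : ℕ} {h h' : ℂ}

lemma fockK_apply (i : ℕ) (f : (ℕ → Bool) → ℂ) (s : ℕ → Bool) : fockK m h h' i f s =
    (if 1 ≤ i ∧ i ≤ m then (if s i then h else h') else 1) * f s := rfl

lemma fockMove_apply (a : Bool) (i : ℕ) (f : (ℕ → Bool) → ℂ) (s : ℕ → Bool) :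
    fockMove m a i f s =
      if (1 ≤ i ∧ i + 1 ≤ m) ∧ s i = a ∧ s (i + 1) = !a then f (setPair i (!a) a s) else 0 := rfl

lemma fockK_mul (hh : h * h' = 1) (i : ℕ) : fockK m h h' i * fockK m h' h i = 1 := by
  ext f s
  simp only [Module.End.mul_apply, fockK_apply, Module.End.one_apply]
  have hh' : h' * h = 1 := by rw [mul_comm, hh]
  split_ifs <;> simp [← mul_assoc, hh, hh']

lemma fockMove_comm (a : Bool) {i j : ℕ} (hij : i + 2 ≤ j ∨ j + 2 ≤ i) :
    fockMove m a i * fockMove m a j = fockMove m a j * fockMove m a i := by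
  ext f s
  have hs : setPair j (!a) a (setPair i (!a) a s) = setPair i (!a) a (setPair j (!a) a s) := by
    funext k; simp only [setPair]; split_ifs <;> first | rfl | omega
  have e₁ : i ≠ j := by omega
  have e₂ : i ≠ j + 1 := by omega
  have e₃ : i + 1 ≠ j := by omega
  simp only [Module.End.mul_apply, fockMove_apply, hs]
  simp only [setPair, e₁, e₁.symm, e₂, e₂.symm, e₃, e₃.symm, if_false, Nat.add_right_cancel_iff]
  split_ifs <;> rfl

lemma fockMove_sq (a : Bool) (i : ℕ) : fockMove m a i * fockMove m a i = 0 := by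
  ext f s
  simp [Module.End.mul_apply, fockMove_apply, setPair]

lemma fockMove_mul_mul (a : Bool) {i j : ℕ} (hij : i + 1 = j ∨ j + 1 = i) :
    fockMove m a i * fockMove m a j * fockMove m a i = 0 := by
  ext f s
  rcases hij with rfl | rfl
  · cases a <;> cases e : s i <;> simp [Module.End.mul_apply, fockMove_apply, setPair, e] <;>
      (intros; omega)
  · cases a <;> cases e : s (j + 1) <;> simp [Module.End.mul_apply, fockMove_apply, setPair, e] <;>
      (intros; omega)

lemma fockMove_mul_not {i j : ℕ} (hij : i ≠ j) :
    fockMove m true i * fockMove m false j = fockMove m false j * fockMove m true i := by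
  ext f s
  by_cases e₂ : i = j + 1
  · subst e₂
    simp +contextual [Module.End.mul_apply, fockMove_apply, setPair]
  by_cases e₃ : i + 1 = j
  · subst e₃
    simp +contextual [Module.End.mul_apply, fockMove_apply, setPair]
  have hs : setPair j true false (setPair i false true s) =
      setPair i false true (setPair j true false s) := by
    funext k; simp only [setPair]; split_ifs <;> first | rfl | omega
  simp only [Module.End.mul_apply, fockMove_apply, hs, Bool.not_true, Bool.not_false]
  simp only [setPair, hij, hij.symm, e₂, Ne.symm e₂, e₃, Ne.symm e₃, if_false,
    Nat.add_right_cancel_iff]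
  split_ifs <;> rfl

lemma setPair_eq_self {i : ℕ} {a b : Bool} {s : ℕ → Bool} (ha : s i = a) (hb : s (i + 1) = b)
    (c d : Bool) : setPair i a b (setPair i c d s) = s := by
  funext k
  simp only [setPair]
  split_ifs with h₁ h₂
  · rw [h₁, ha]
  · rw [h₂, hb]
  · rfl

/-- Values of the Fock representation on generators. -/
noncomputable def fockGen (m : ℕ) (h : ℂ) : Gen → Module.End ℂ ((ℕ → Bool) → ℂ)
  | .K i => fockK m h h⁻¹ i
  | .Ki i => fockK m h⁻¹ h i
  | .E i => fockMove m true i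
  | .F i => fockMove m false i

lemma fockGen_rel {q : ℝ} (hh : h ^ 2 = q) (h0 : h ≠ 0) (hq : (q : ℂ) - (q : ℂ)⁻¹ ≠ 0)
    ⦃x y : FA⦄ (hxy : Rel q m x y) :
    FreeAlgebra.lift ℂ (fockGen m h) x = FreeAlgebra.lift ℂ (fockGen m h) y := by
  cases hxy with
  | Kout i hi => ext f s; simp [fK, fockGen, fockK_apply, hi]
  | Kiout i hi => ext f s; simp [fKi, fockGen, fockK_apply, hi]
  | Eout i hi => ext f s; simp only [fE, fockGen, FreeAlgebra.lift_ι_apply, fockMove_apply, hi]; simp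
  | Fout i hi => ext f s; simp only [fF, fockGen, FreeAlgebra.lift_ι_apply, fockMove_apply, hi]; simp
  | KK i j =>
    ext f s
    simp only [fK, fockGen, map_mul, FreeAlgebra.lift_ι_apply, Module.End.mul_apply, fockK_apply]
    ring
  | KKi i => simpa [fK, fKi, fockGen] using fockK_mul (mul_inv_cancel₀ h0) i
  | KiK i => simpa [fK, fKi, fockGen] using fockK_mul (inv_mul_cancel₀ h0) i
  | KE i j hi hi' hj hj' =>
    ext f s
    rw [← hh]
    simp only [fK, fE, fockGen, map_mul, map_smul, FreeAlgebra.lift_ι_apply, Module.End.mul_apply,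
      fockK_apply, fockMove_apply, LinearMap.smul_apply, Pi.smul_apply, smul_eq_mul, hi, hi', hj,
      hj', and_self, true_and, if_true, setPair, kd, Bool.not_true]
    by_cases hs : s j = true ∧ s (j + 1) = false
    · by_cases e₁ : i = j
      · subst e₁; simp [hs]; field_simp
      · by_cases e₂ : i = j + 1
        · subst e₂; simp [hs]; field_simp
        · simp [hs, e₁, e₂]
    · simp [hs]
  | KF i j hi hi' hj hj' =>
    ext f s
    rw [← hh]
    simp only [fK, fF, fockGen, map_mul, map_smul, FreeAlgebra.lift_ι_apply, Module.End.mul_apply,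
      fockK_apply, fockMove_apply, LinearMap.smul_apply, Pi.smul_apply, smul_eq_mul, hi, hi', hj,
      hj', and_self, true_and, if_true, setPair, kd, Bool.not_false]
    by_cases hs : s j = false ∧ s (j + 1) = true
    · by_cases e₁ : i = j
      · subst e₁; simp [hs]; field_simp
      · by_cases e₂ : i = j + 1
        · subst e₂; simp [hs]; field_simp
        · simp [hs, e₁, e₂]
    · simp [hs]
  | EF i j hi hi' hj hj' =>
    rw [apply_ite (FreeAlgebra.lift ℂ (fockGen m h))]
    simp only [fE, fF, fK, fKi, fockGen, map_mul, map_sub, map_smul, map_zero,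
      FreeAlgebra.lift_ι_apply]
    split_ifs with hij
    · subst hij
      ext f s
      rw [← hh] at hq ⊢
      have hi'' : i ≤ m := by omega
      simp only [Module.End.mul_apply, LinearMap.sub_apply, LinearMap.smul_apply, Pi.sub_apply,
        Pi.smul_apply, smul_eq_mul, fockK_apply, fockMove_apply, hi, hi', hi'', and_self, true_and,
        if_true, Bool.not_true, Bool.not_false, le_add_iff_nonneg_left, Nat.zero_le]
      rw [eq_inv_mul_iff_mul_eq₀ hq]
      cases e₁ : s i <;> cases e₂ : s (i + 1) <;> simp [setPair_eq_self e₁ e₂] <;>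
        (try simp [setPair]) <;> field_simp <;> ring
    · rw [fockMove_mul_not hij, sub_self]
  | EE i j hi hi' hj hj' hij => simpa [fE, fockGen] using fockMove_comm true hij
  | FF i j hi hi' hj hj' hij => simpa [fF, fockGen] using fockMove_comm false hij
  | Eserre i j hi hi' hj hj' hij =>
    simp [fE, fockGen, pow_two, fockMove_sq, fockMove_mul_mul true hij]
  | Fserre i j hi hi' hj hj' hij =>
    simp [fF, fockGen, pow_two, fockMove_sq, fockMove_mul_mul false hij]

/-- The Fock representation of `U_q(gl(m))` on functions of occupation patterns. -/
noncomputable def fock {q : ℝ} (m : ℕ) (hh : h ^ 2 = q) (h0 : h ≠ 0) (hq : (q : ℂ) - (q : ℂ)⁻¹ ≠ 0) :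
    Uq q m →ₐ[ℂ] Module.End ℂ ((ℕ → Bool) → ℂ) :=
  RingQuot.liftAlgHom ℂ ⟨FreeAlgebra.lift ℂ (fockGen m h), fockGen_rel hh h0 hq⟩

variable {q : ℝ} (hh : h ^ 2 = q) (h0 : h ≠ 0) (hq : (q : ℂ) - (q : ℂ)⁻¹ ≠ 0)

@[simp] lemma fock_uK (i : ℕ) : fock m hh h0 hq (uK q m i) = fockK m h h⁻¹ i := by
  simp [fock, uK, fK, fockGen]

@[simp] lemma fock_uKi (i : ℕ) : fock m hh h0 hq (uKi q m i) = fockK m h⁻¹ h i := by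
  simp [fock, uKi, fKi, fockGen]

@[simp] lemma fock_uE (i : ℕ) : fock m hh h0 hq (uE q m i) = fockMove m true i := by
  simp [fock, uE, fE, fockGen]

@[simp] lemma fock_uF (i : ℕ) : fock m hh h0 hq (uF q m i) = fockMove m false i := by
  simp [fock, uF, fF, fockGen]

end Fock

/-! ### Characters of `𝒜` and the associated homomorphisms `𝒜 → U_q(gl(2n))` -/

section Aalg

variable {q : ℝ} {n : ℕ}

lemma aγ_of_not {i : ℕ} (h : ¬(1 ≤ i ∧ i ≤ 2 * n)) : aγ q n i = 1 := by
  simpa [aγ] using RingQuot.mkAlgHom_rel ℂ (ARel.gout (q := q) i h)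

lemma aγi_of_not {i : ℕ} (h : ¬(1 ≤ i ∧ i ≤ 2 * n)) : aγi q n i = 1 := by
  simpa [aγi] using RingQuot.mkAlgHom_rel ℂ (ARel.giout (q := q) i h)

lemma aβ_of_not {j : ℕ} (h : ¬(1 ≤ j ∧ j + 1 ≤ 2 * n)) : aβ q n j = 0 := by
  simpa [aβ] using RingQuot.mkAlgHom_rel ℂ (ARel.bout (q := q) j h)

/-- Induction principle for `𝒜`: it suffices to treat scalars, generators, sums and products. -/
lemma Aalg.induction {C : Aalg q n → Prop} (hc : ∀ c : ℂ, C (algebraMap ℂ _ c))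
    (hγ : ∀ i, 1 ≤ i → i ≤ 2 * n → C (aγ q n i)) (hγi : ∀ i, 1 ≤ i → i ≤ 2 * n → C (aγi q n i))
    (hβ : ∀ j, 1 ≤ j → j + 1 ≤ 2 * n → C (aβ q n j)) (hadd : ∀ a b, C a → C b → C (a + b))
    (hmul : ∀ a b, C a → C b → C (a * b)) (a : Aalg q n) : C a := by
  obtain ⟨x, rfl⟩ := RingQuot.mkAlgHom_surjective ℂ (ARel q n) a
  induction x using FreeAlgebra.induction with
  | grade0 c => simpa using hc c
  | grade1 x =>
    have h0 : C 0 := by simpa using hc 0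
    have h1 : C 1 := by simpa using hc 1
    cases x with
    | g i =>
      change C (aγ q n i)
      by_cases h : 1 ≤ i ∧ i ≤ 2 * n
      · exact hγ i h.1 h.2
      · rwa [aγ_of_not h]
    | gi i =>
      change C (aγi q n i)
      by_cases h : 1 ≤ i ∧ i ≤ 2 * n
      · exact hγi i h.1 h.2
      · rwa [aγi_of_not h]
    | b j =>
      change C (aβ q n j)
      by_cases h : 1 ≤ j ∧ j + 1 ≤ 2 * n
      · exact hβ j h.1 h.2
      · rwa [aβ_of_not h]
  | mul a b ha hb => rw [map_mul]; exact hmul _ _ ha hb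
  | add a b ha hb => rw [map_add]; exact hadd _ _ ha hb

/-- Homomorphisms out of `𝒜` that agree on generators are equal. -/
lemma Aalg.hom_ext {R : Type*} [Semiring R] [Algebra ℂ R] {f g : Aalg q n →ₐ[ℂ] R}
    (hγ : ∀ i, 1 ≤ i → i ≤ 2 * n → f (aγ q n i) = g (aγ q n i))
    (hγi : ∀ i, 1 ≤ i → i ≤ 2 * n → f (aγi q n i) = g (aγi q n i))
    (hβ : ∀ j, 1 ≤ j → j + 1 ≤ 2 * n → f (aβ q n j) = g (aβ q n j)) : f = g :=
  AlgHom.ext <| Aalg.induction (fun c => by simp) hγ hγi hβ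
    (fun a b ha hb => by rw [map_add, map_add, ha, hb])
    (fun a b ha hb => by rw [map_mul, map_mul, ha, hb])

/-- Values on generators of the character of `𝒜` with parameter `c`. -/
def charGen (n : ℕ) (c : ℂ) : AGen → ℂ
  | .g _ => 1
  | .gi _ => 1
  | .b j => if j = n then c else 0

lemma charGen_rel (hn : 1 ≤ n) (c : ℂ) ⦃x y : AFA⦄ (h : ARel q n x y) :
    FreeAlgebra.lift ℂ (charGen n c) x = FreeAlgebra.lift ℂ (charGen n c) y := by
  cases h with
  | gout i h => simp [fγ, charGen]
  | giout i h => simp [fγi, charGen]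
  | bout j h =>
    have : j ≠ n := by omega
    simp [fβ, charGen, this]
  | gg i j => simp [fγ, charGen]
  | ggi i => simp [fγ, fγi, charGen]
  | gig i => simp [fγ, fγi, charGen]
  | gsym i hi hi' => simp [fγ, charGen]
  | gb i j hi hi' hj hj' =>
    by_cases h : j = n
    · have : gex n i j = 0 := by simp only [gex, kd]; split_ifs <;> omega
      simp [fγ, fβ, charGen, this]
    · simp [fγ, fβ, charGen, h]
  | bb i j hi hi' hj hj' h =>
    rw [apply_ite (FreeAlgebra.lift ℂ (charGen n c))]
    simp [fβ, fγi, charGen, mul_comm]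
  | serre1 i hi hi' =>
    rw [apply_ite (FreeAlgebra.lift ℂ (charGen n c))]
    simp only [map_add, map_sub, map_smul]
    by_cases h : i = n <;> simp [fβ, charGen, h]
  | serre2 i hi hi' =>
    rw [apply_ite (FreeAlgebra.lift ℂ (charGen n c))]
    simp only [map_add, map_sub, map_smul]
    have : n - 1 ≠ n := by omega
    by_cases h : i = n <;> simp [fβ, charGen, h, this]

/-- The character of `𝒜` sending `β_n` to `c`, the `β_j` with `j ≠ n` to `0` and
the `γ_i` to `1`. -/
noncomputable def character (q : ℝ) (hn : 1 ≤ n) (c : ℂ) : Aalg q n →ₐ[ℂ] ℂ :=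
  RingQuot.liftAlgHom ℂ ⟨FreeAlgebra.lift ℂ (charGen n c), charGen_rel hn c⟩

@[simp] lemma character_aγ (hn : 1 ≤ n) (c : ℂ) (i : ℕ) : character q hn c (aγ q n i) = 1 := by
  simp [character, aγ, fγ, charGen]

@[simp] lemma character_aγi (hn : 1 ≤ n) (c : ℂ) (i : ℕ) : character q hn c (aγi q n i) = 1 := by
  simp [character, aγi, fγi, charGen]

@[simp] lemma character_aβ (hn : 1 ≤ n) (c : ℂ) (j : ℕ) :
    character q hn c (aβ q n j) = if j = n then c else 0 := by
  simp [character, aβ, fβ, charGen]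

/-- The values on generators characterizing the coaction `δ_𝒜`. -/
def IsCoaction (δA : Aalg q n →ₐ[ℂ] Aalg q n ⊗[ℂ] Uq q (2 * n)) : Prop :=
  (∀ i, 1 ≤ i → i ≤ 2 * n →
      δA (aγ q n i) = aγ q n i ⊗ₜ[ℂ] (uK q (2 * n) i * uK q (2 * n) (2 * n + 1 - i)) ∧
      δA (aγi q n i) = aγi q n i ⊗ₜ[ℂ] (uKi q (2 * n) i * uKi q (2 * n) (2 * n + 1 - i))) ∧
  ∀ j, 1 ≤ j → j + 1 ≤ 2 * n →
      δA (aβ q n j) =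
        aβ q n j ⊗ₜ[ℂ] (uKi q (2 * n) j * uKi q (2 * n) (2 * n - j))
        + aγi q n (j + 1) ⊗ₜ[ℂ]
            (uF q (2 * n) j * uKi q (2 * n) (j + 1) * uKi q (2 * n) (2 * n - j))
        + aγi q n j ⊗ₜ[ℂ] (uKi q (2 * n) j * uE q (2 * n) (2 * n - j) * uKi q (2 * n) (2 * n - j))

/-- The homomorphism `(χ ⊗ id) ∘ δ_𝒜` for the character `χ` with parameter `c`. -/
noncomputable def embed (δA : Aalg q n →ₐ[ℂ] Aalg q n ⊗[ℂ] Uq q (2 * n)) (hn : 1 ≤ n) (c : ℂ) :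
    Aalg q n →ₐ[ℂ] Uq q (2 * n) :=
  (Algebra.TensorProduct.lid ℂ (Uq q (2 * n))).toAlgHom.comp
    ((Algebra.TensorProduct.map (character q hn c) (AlgHom.id ℂ (Uq q (2 * n)))).comp δA)

variable {δA : Aalg q n →ₐ[ℂ] Aalg q n ⊗[ℂ] Uq q (2 * n)}

lemma embed_aγ (hδ : IsCoaction δA) (hn : 1 ≤ n) (c : ℂ) {i : ℕ} (hi : 1 ≤ i)
    (hi' : i ≤ 2 * n) : embed δA hn c (aγ q n i) = Cc q n i := by
  simp [embed, (hδ.1 i hi hi').1, Cc]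

lemma embed_aγi (hδ : IsCoaction δA) (hn : 1 ≤ n) (c : ℂ) {i : ℕ} (hi : 1 ≤ i)
    (hi' : i ≤ 2 * n) : embed δA hn c (aγi q n i) = Ccinv q n i := by
  simp [embed, (hδ.1 i hi hi').2, Ccinv]

lemma embed_aβ (hδ : IsCoaction δA) (hn : 1 ≤ n) (c : ℂ) {j : ℕ} (hj : 1 ≤ j)
    (hj' : j + 1 ≤ 2 * n) : embed δA hn c (aβ q n j) =
      (if j = n then c else 0) • (uKi q (2 * n) j * uKi q (2 * n) (2 * n - j)) + Bb q n j := by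
  simp [embed, hδ.2 j hj hj', Bb, add_assoc]

/-- `embed` intertwines the coaction with the coproduct. -/
lemma comul_embed (hδ : IsCoaction δA) (hn : 1 ≤ n) (hq : (q : ℂ) ≠ 0) (c : ℂ) :
    (comul hq).comp (embed δA hn c) =
      (Algebra.TensorProduct.map (embed δA hn c) (AlgHom.id ℂ (Uq q (2 * n)))).comp δA := by
  refine Aalg.hom_ext (fun i hi hi' => ?_) (fun i hi hi' => ?_) (fun j hj hj' => ?_)
  · simp [embed_aγ hδ hn c hi hi', (hδ.1 i hi hi').1, Cc]
  · simp [embed_aγi hδ hn c hi hi', (hδ.1 i hi hi').2, Ccinv]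
  · have e₁ : 2 * n + 1 - (j + 1) = 2 * n - j := by omega
    have e₂ : 2 * n + 1 - j = 2 * n - j + 1 := by omega
    have s₁ (x : Uq q (2 * n)) : kki q (2 * n) j * (uKi q (2 * n) (j + 1) * x)
        = uKi q (2 * n) j * x := by
      rw [kki, mul_assoc, ← mul_assoc (uK q (2 * n) (j + 1)), uK_mul_uKi, one_mul]
    have s₂ : kk q (2 * n) (2 * n - j) * uKi q (2 * n) (2 * n - j)
        = uKi q (2 * n) (2 * n - j + 1) := by
      rw [kk, mul_assoc, (uKi_commute _ _).eq, ← mul_assoc, uK_mul_uKi, one_mul]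
    simp only [AlgHom.comp_apply, embed_aβ hδ hn c hj hj', hδ.2 j hj hj', map_add, map_mul,
      map_smul, Algebra.TensorProduct.map_tmul, embed_aγi hδ hn c (Nat.le_add_left 1 j) hj',
      embed_aγi hδ hn c hj (by omega : j ≤ 2 * n), AlgHom.id_apply, Bb, Ccinv, e₁, e₂, comul_uKi,
      comul_uE, comul_uF, Algebra.TensorProduct.tmul_mul_tmul, add_mul, mul_add, one_mul,
      TensorProduct.add_tmul, TensorProduct.smul_tmul', mul_assoc, s₁, s₂]
    abel

end Aalg

/-! ### A joint eigenvector of the coideal subalgebra in the Fock representation -/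

section Vacuum

/-- The weight of a pair of occupations: exactly one of the two sites has to be occupied, and `r`
is the weight of the first one being occupied. -/
def pairWeight (r : ℂ) : Bool → Bool → ℂ
  | true, false => r
  | false, true => 1
  | _, _ => 0

/-- The joint eigenvector, as a product over the pairs of sites `i`, `2n + 1 - i`. -/
noncomputable def eigenvec (n : ℕ) (q p : ℂ) (s : ℕ → Bool) : ℂ :=
  ∏ i ∈ Finset.Icc 1 n, pairWeight ((-q) ^ (n - i) * p⁻¹) (s i) (s (2 * n + 1 - i))

variable {n : ℕ} {q p : ℂ}

lemma pairWeight_self (r : ℂ) (a : Bool) : pairWeight r a a = 0 := by cases a <;> rfl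

lemma eigenvec_eq_zero {s : ℕ → Bool} {i j : ℕ} (hi : 1 ≤ i) (hj : 1 ≤ j)
    (hij : i + j = 2 * n + 1) (h : s i = s j) : eigenvec n q p s = 0 := by
  rcases le_or_gt i n with hin | hin
  · refine Finset.prod_eq_zero (Finset.mem_Icc.2 ⟨hi, hin⟩) ?_
    rw [show 2 * n + 1 - i = j by omega, h, pairWeight_self]
  · refine Finset.prod_eq_zero (Finset.mem_Icc.2 ⟨hj, (by omega : j ≤ n)⟩) ?_
    rw [show 2 * n + 1 - j = i by omega, h, pairWeight_self]

/-- Moving the pattern of one pair to the next one changes `eigenvec` by the factor `-q`. -/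
lemma eigenvec_add_eq_zero {s t : ℕ → Bool} {i j : ℕ} (hi : 1 ≤ i) (hin : i < n)
    (hij : i + j = 2 * n)
    (hst : ∀ k, k ≠ i → k ≠ i + 1 → k ≠ j → k ≠ j + 1 → s k = t k)
    (s₁ : s i = true) (s₂ : s (i + 1) = false) (s₃ : s j = true) (s₄ : s (j + 1) = false)
    (t₁ : t i = false) (t₂ : t (i + 1) = true) (t₃ : t j = false) (t₄ : t (j + 1) = true) :
    eigenvec n q p s + q * eigenvec n q p t = 0 := by
  have hi' : i ∈ Finset.Icc 1 n := Finset.mem_Icc.2 ⟨hi, hin.le⟩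
  have hi'' : i + 1 ∈ (Finset.Icc 1 n).erase i :=
    Finset.mem_erase.2 ⟨by omega, Finset.mem_Icc.2 ⟨by omega, hin⟩⟩
  have key : ∏ k ∈ ((Finset.Icc 1 n).erase i).erase (i + 1),
        pairWeight ((-q) ^ (n - k) * p⁻¹) (s k) (s (2 * n + 1 - k)) =
      ∏ k ∈ ((Finset.Icc 1 n).erase i).erase (i + 1),
        pairWeight ((-q) ^ (n - k) * p⁻¹) (t k) (t (2 * n + 1 - k)) := by
    refine Finset.prod_congr rfl fun k hk => ?_
    simp only [Finset.mem_erase, Finset.mem_Icc] at hk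
    rw [hst k (by omega) (by omega) (by omega) (by omega),
      hst (2 * n + 1 - k) (by omega) (by omega) (by omega) (by omega)]
  rw [eigenvec, eigenvec, ← Finset.mul_prod_erase _ _ hi', ← Finset.mul_prod_erase _ _ hi'',
    ← Finset.mul_prod_erase _ _ hi', ← Finset.mul_prod_erase _ _ hi'', key,
    show 2 * n + 1 - i = j + 1 by omega, show 2 * n + 1 - (i + 1) = j by omega, s₁, s₂, s₃, s₄,
    t₁, t₂, t₃, t₄, show n - i = n - (i + 1) + 1 by omega, pow_succ]
  simp only [pairWeight]
  ring

lemma eigenvec_middle {s t : ℕ → Bool} (hn : 1 ≤ n)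
    (hst : ∀ k, k ≠ n → k ≠ n + 1 → s k = t k)
    (s₁ : s n = true) (s₂ : s (n + 1) = false) (t₁ : t n = false) (t₂ : t (n + 1) = true) :
    eigenvec n q p s = p⁻¹ * eigenvec n q p t := by
  have hn' : n ∈ Finset.Icc 1 n := Finset.mem_Icc.2 ⟨hn, le_rfl⟩
  have key : ∏ k ∈ (Finset.Icc 1 n).erase n,
        pairWeight ((-q) ^ (n - k) * p⁻¹) (s k) (s (2 * n + 1 - k)) =
      ∏ k ∈ (Finset.Icc 1 n).erase n,
        pairWeight ((-q) ^ (n - k) * p⁻¹) (t k) (t (2 * n + 1 - k)) := by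
    refine Finset.prod_congr rfl fun k hk => ?_
    simp only [Finset.mem_erase, Finset.mem_Icc] at hk
    rw [hst k (by omega) (by omega), hst (2 * n + 1 - k) (by omega) (by omega)]
  rw [eigenvec, eigenvec, ← Finset.mul_prod_erase _ _ hn', ← Finset.mul_prod_erase _ _ hn', key,
    show 2 * n + 1 - n = n + 1 by omega, s₁, s₂, t₁, t₂]
  simp [pairWeight]

lemma eigenvec_vacuum : eigenvec n q p (fun k => decide (n < k)) = 1 := by
  refine Finset.prod_eq_one fun i hi => ?_
  rw [Finset.mem_Icc] at hi
  have h₁ : ¬ n < i := by omega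
  have h₂ : n < 2 * n + 1 - i := by omega
  simp [pairWeight, h₁, h₂]

variable {h : ℂ}

lemma fockK_mul_fockK_eigenvec {k : ℂ} (hk : h * k = 1) {i j : ℕ} (hi : 1 ≤ i) (hj : 1 ≤ j)
    (hij : i + j = 2 * n + 1) :
    fockK (2 * n) h k i (fockK (2 * n) h k j (eigenvec n q p)) = eigenvec n q p := by
  ext s
  by_cases hs : s i = s j
  · simp [fockK_apply, eigenvec_eq_zero hi hj hij hs]
  · have hk' : k * h = 1 := by rw [mul_comm, hk]
    have hi' : i ≤ 2 * n := by omega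
    have hj' : j ≤ 2 * n := by omega
    rw [fockK_apply, fockK_apply, ← mul_assoc]
    cases h₁ : s i <;> cases h₂ : s j <;> simp_all

lemma fock_Bb_eigenvec (hh : h ^ 2 = q) (h0 : h ≠ 0) {i j : ℕ} (hi : 1 ≤ i) (hj : 1 ≤ j)
    (hij : i + j = 2 * n) (hne : i ≠ j) :
    fockMove (2 * n) false j (fockK (2 * n) h⁻¹ h (j + 1) (fockK (2 * n) h⁻¹ h i
        (eigenvec n q p)))
      + fockK (2 * n) h⁻¹ h j (fockMove (2 * n) true i (fockK (2 * n) h⁻¹ h i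
        (eigenvec n q p))) = 0 := by
  ext s
  have hi' : i + 1 ≤ 2 * n := by omega
  have hi'' : i ≤ 2 * n := by omega
  have hj' : j + 1 ≤ 2 * n := by omega
  have hj'' : j ≤ 2 * n := by omega
  have e₁ : i ≠ j + 1 := by omega
  have e₂ : j ≠ i + 1 := by omega
  by_cases hs : s j = false ∧ s (j + 1) = true ∧ s i = true ∧ s (i + 1) = false
  · obtain ⟨a₁, a₂, a₃, a₄⟩ := hs
    have key : eigenvec n q p (setPair j true false s)
        + q * eigenvec n q p (setPair i false true s) = 0 := by
      rcases lt_or_gt_of_ne hne with hlt | hlt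
      · refine eigenvec_add_eq_zero (i := i) (j := j) hi (by omega) hij
          (fun k k₁ k₂ k₃ k₄ => ?_) ?_ ?_ ?_ ?_ ?_ ?_ ?_ ?_
          <;> simp [setPair, *, hne.symm, e₁.symm, e₂.symm]
      · refine eigenvec_add_eq_zero (i := j) (j := i) hj (by omega) (by omega) (fun k k₁ k₂ k₃ k₄ => ?_)
          ?_ ?_ ?_ ?_ ?_ ?_ ?_ ?_
          <;> simp [setPair, *, hne.symm, e₁.symm, e₂.symm]
    rw [← hh] at key
    simp only [Pi.add_apply, fockMove_apply, fockK_apply, hi, hi', hi'', hj, hj', hj'', a₁, a₂,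
      a₃, a₄, setPair, hne, e₁]
    simp [h0, pow_two, ← mul_assoc, ← hh] at key ⊢
    exact key
  · have z₁ : s j = false → s (j + 1) = true →
        eigenvec n q p (setPair j true false s) = 0 := fun b₁ b₂ => by
      by_cases b₃ : s i = true
      · refine eigenvec_eq_zero (i := i + 1) (j := j) (by omega) hj (by omega) ?_
        have : s (i + 1) = true := by simpa [b₁, b₂, b₃] using hs
        simp [setPair, this, hne, e₂.symm]
      · refine eigenvec_eq_zero (i := i) (j := j + 1) hi (by omega) (by omega) ?_
        simpa [setPair, hne, e₁, e₂] using b₃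
    have z₂ : s i = true → s (i + 1) = false →
        eigenvec n q p (setPair i false true s) = 0 := fun b₁ b₂ => by
      by_cases b₃ : s j = false
      · refine eigenvec_eq_zero (i := j + 1) (j := i) (by omega) hi (by omega) ?_
        have : s (j + 1) = false := by simpa [b₁, b₂, b₃] using hs
        simp [setPair, this, hne.symm, e₁.symm]
      · refine eigenvec_eq_zero (i := j) (j := i + 1) hj (by omega) (by omega) ?_
        simpa [setPair, hne.symm, e₁, e₂] using b₃
    simp only [Pi.add_apply, fockMove_apply, fockK_apply, Bool.not_true, Bool.not_false]
    split_ifs <;> simp_all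

lemma fock_Bs_eigenvec (hh : h ^ 2 = q) (h0 : h ≠ 0) (hp : p ≠ 0) (hq : q - q⁻¹ ≠ 0)
    (hn : 1 ≤ n) :
    fockMove (2 * n) false n (fockK (2 * n) h⁻¹ h (n + 1) (fockK (2 * n) h⁻¹ h n
        (eigenvec n q p)))
      + fockK (2 * n) h⁻¹ h n (fockMove (2 * n) true n (fockK (2 * n) h⁻¹ h n
        (eigenvec n q p)))
      + ((p - p⁻¹) / (q - q⁻¹)) • fockK (2 * n) h⁻¹ h n (fockK (2 * n) h⁻¹ h n (eigenvec n q p))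
      = ((p * q - (p * q)⁻¹) / (q - q⁻¹)) • eigenvec n q p := by
  ext s
  have hq0 : q ≠ 0 := by rw [← hh]; positivity
  have hn₁ : n ≤ 2 * n := by omega
  have hn₂ : n + 1 ≤ 2 * n := by omega
  have i₁ : p⁻¹ + (p - p⁻¹) / (q - q⁻¹) * q = (p * q - (p * q)⁻¹) / (q - q⁻¹) := by
    rw [eq_div_iff hq, add_mul, mul_right_comm, div_mul_cancel₀ _ hq]
    field_simp
    ring
  have i₂ : p + (p - p⁻¹) / (q - q⁻¹) * q⁻¹ = (p * q - (p * q)⁻¹) / (q - q⁻¹) := by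
    rw [eq_div_iff hq, add_mul, mul_right_comm, div_mul_cancel₀ _ hq]
    field_simp
    ring
  by_cases hs : s n = s (n + 1)
  · have hz := eigenvec_eq_zero (n := n) (q := q) (p := p) hn (by omega : 1 ≤ n + 1)
      (by omega) hs
    simp [fockMove_apply, fockK_apply, hz, hs]
  · cases s₁ : s n
    · have s₂ : s (n + 1) = true := by rw [s₁] at hs; simpa using hs
      have key : eigenvec n q p (setPair n true false s) = p⁻¹ * eigenvec n q p s :=
        eigenvec_middle hn (fun k k₁ k₂ => by simp [setPair, k₁, k₂]) (by simp [setPair])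
          (by simp [setPair]) s₁ s₂
      have hl : h * (h⁻¹ * (p⁻¹ * eigenvec n q p s))
          + (p - p⁻¹) / (q - q⁻¹) * (h * (h * eigenvec n q p s))
          = (p * q - (p * q)⁻¹) / (q - q⁻¹) * eigenvec n q p s := by
        rw [← i₁, mul_inv_cancel_left₀ h0, ← mul_assoc h h, ← pow_two, hh]
        ring
      simp only [Pi.add_apply, Pi.smul_apply, smul_eq_mul, fockMove_apply, fockK_apply, s₁, s₂]
      rw [← key] at hl
      simpa [setPair, hn, hn₁, hn₂] using hl
    · have s₂ : s (n + 1) = false := by rw [s₁] at hs; simpa using hs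
      have key : eigenvec n q p (setPair n false true s) = p * eigenvec n q p s := by
        rw [eigenvec_middle (t := setPair n false true s) hn
          (fun k k₁ k₂ => by simp [setPair, k₁, k₂]) s₁ s₂ (by simp [setPair])
          (by simp [setPair]), mul_inv_cancel_left₀ hp]
      have hl : h⁻¹ * (h * (p * eigenvec n q p s))
          + (p - p⁻¹) / (q - q⁻¹) * (h⁻¹ * (h⁻¹ * eigenvec n q p s))
          = (p * q - (p * q)⁻¹) / (q - q⁻¹) * eigenvec n q p s := by
        rw [← i₂, inv_mul_cancel_left₀ h0, ← mul_assoc h⁻¹ h⁻¹, ← mul_inv, ← pow_two, hh]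
        ring
      simp only [Pi.add_apply, Pi.smul_apply, smul_eq_mul, fockMove_apply, fockK_apply, s₁, s₂]
      rw [← key] at hl
      simpa [setPair, hn, hn₁, hn₂] using hl

end Vacuum

/-! ### Injectivity of `embed` is invariant under shifts of the parameter -/

section Shift

variable {q : ℝ} {n : ℕ} {δA : Aalg q n →ₐ[ℂ] Aalg q n ⊗[ℂ] Uq q (2 * n)}

/-- The `q`-number attached to `p`; for `p = q ^ (-σ)` it is the parameter of `B_n^σ`. -/
noncomputable def qnum (q : ℝ) (p : ℂ) : ℂ := (p - p⁻¹) / ((q : ℂ) - (q : ℂ)⁻¹)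

lemma qnum_neg_inv (p : ℂ) : qnum q (-p⁻¹) = qnum q p := by
  rw [qnum, qnum, inv_neg, inv_inv]
  ring

/-- `eigenvec` is a joint eigenvector of the image of `embed`, with the shifted character. -/
lemma fock_embed_eigenvec (hδ : IsCoaction δA) (hn : 1 ≤ n) {h p : ℂ} (hh : h ^ 2 = q)
    (h0 : h ≠ 0) (hq : (q : ℂ) - (q : ℂ)⁻¹ ≠ 0) (hp : p ≠ 0) (a : Aalg q n) :
    fock (2 * n) hh h0 hq (embed δA hn (qnum q p) a) (eigenvec n q p) =
      character q hn (qnum q (p * q)) a • eigenvec n q p := by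
  induction a using Aalg.induction with
  | hc c => simp [Algebra.algebraMap_eq_smul_one]
  | hγ i hi hi' =>
    rw [embed_aγ hδ hn _ hi hi', character_aγ, one_smul, Cc, map_mul, fock_uK, fock_uK]
    exact fockK_mul_fockK_eigenvec (mul_inv_cancel₀ h0) hi (by omega) (by omega)
  | hγi i hi hi' =>
    rw [embed_aγi hδ hn _ hi hi', character_aγi, one_smul, Ccinv, map_mul, fock_uKi, fock_uKi]
    exact fockK_mul_fockK_eigenvec (inv_mul_cancel₀ h0) hi (by omega) (by omega)
  | hβ j hj hj' =>
    rw [embed_aβ hδ hn _ hj hj', character_aβ]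
    split_ifs with hjn
    · subst hjn
      have key := fock_Bs_eigenvec hh h0 hp hq hn
      rw [← qnum, ← qnum] at key
      rw [← key, show 2 * j - j = j by omega, add_comm (_ • _)]
      simp [Bb, show 2 * j - j = j by omega]
    · have key := fock_Bb_eigenvec (n := n) (p := p) hh h0 (i := 2 * n - j) (j := j) (by omega) hj
        (by omega) (by omega)
      rw [zero_smul, zero_add, zero_smul, ← key]
      simp [Bb]
  | hadd a b ha hb => simp only [map_add, LinearMap.add_apply, ha, hb, add_smul]
  | hmul a b ha hb =>
    simp only [map_mul, Module.End.mul_apply, hb, map_smul, ha, smul_smul]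
    rw [mul_comm]

/-- The vacuum matrix coefficient of the vector `eigenvec` in the Fock representation. -/
noncomputable def vacuumCoeff (n : ℕ) {h : ℂ} (hh : h ^ 2 = q) (h0 : h ≠ 0)
    (hq : (q : ℂ) - (q : ℂ)⁻¹ ≠ 0) (p : ℂ) : Uq q (2 * n) →ₗ[ℂ] ℂ :=
  LinearMap.proj (fun k => decide (n < k)) ∘ₗ LinearMap.applyₗ (eigenvec n q p) ∘ₗ
    (fock (2 * n) hh h0 hq).toLinearMap

lemma vacuumCoeff_embed (hδ : IsCoaction δA) (hn : 1 ≤ n) {h p : ℂ} (hh : h ^ 2 = q)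
    (h0 : h ≠ 0) (hq : (q : ℂ) - (q : ℂ)⁻¹ ≠ 0) (hp : p ≠ 0) (a : Aalg q n) :
    vacuumCoeff n hh h0 hq p (embed δA hn (qnum q p) a) =
      character q hn (qnum q (p * q)) a := by
  change fock (2 * n) hh h0 hq (embed δA hn (qnum q p) a) (eigenvec n q p)
    (fun k => decide (n < k)) = _
  rw [fock_embed_eigenvec hδ hn hh h0 hq hp, Pi.smul_apply, eigenvec_vacuum, smul_eq_mul, mul_one]

lemma embed_eq_vacuumCoeff (hδ : IsCoaction δA) (hn : 1 ≤ n) {h p : ℂ} (hh : h ^ 2 = q)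
    (h0 : h ≠ 0) (hq0 : (q : ℂ) ≠ 0) (hq : (q : ℂ) - (q : ℂ)⁻¹ ≠ 0) (hp : p ≠ 0) (a : Aalg q n) :
    embed δA hn (qnum q (p * q)) a =
      TensorProduct.lid ℂ _ (TensorProduct.map (vacuumCoeff n hh h0 hq p) LinearMap.id
        (comul hq0 (embed δA hn (qnum q p) a))) := by
  have h₁ : comul hq0 (embed δA hn (qnum q p) a) = _ :=
    DFunLike.congr_fun (comul_embed hδ hn hq0 (qnum q p)) a
  rw [h₁]
  change Algebra.TensorProduct.lid ℂ (Uq q (2 * n)) (Algebra.TensorProduct.map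
    (character q hn (qnum q (p * q))) (AlgHom.id ℂ (Uq q (2 * n))) (δA a)) =
    TensorProduct.lid ℂ _ (TensorProduct.map (vacuumCoeff n hh h0 hq p) LinearMap.id
      (Algebra.TensorProduct.map (embed δA hn (qnum q p)) (AlgHom.id ℂ (Uq q (2 * n))) (δA a)))
  induction δA a using TensorProduct.induction_on with
  | zero => simp
  | tmul x y => simp [vacuumCoeff_embed hδ hn hh h0 hq hp]
  | add x y hx hy => simp only [map_add, hx, hy]

lemma injective_embed_of_mul (hδ : IsCoaction δA) (hn : 1 ≤ n) (hq0 : (q : ℂ) ≠ 0)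
    (hq : (q : ℂ) - (q : ℂ)⁻¹ ≠ 0) {p : ℂ} (hp : p ≠ 0)
    (hinj : Function.Injective (embed δA hn (qnum q (p * q)))) :
    Function.Injective (embed δA hn (qnum q p)) := by
  obtain ⟨h, hh⟩ := IsAlgClosed.exists_pow_nat_eq (q : ℂ) two_pos
  have h0 : h ≠ 0 := by rintro rfl; exact hq0 (by rw [← hh]; simp)
  refine (injective_iff_map_eq_zero _).2 fun a ha => (injective_iff_map_eq_zero _).1 hinj a ?_
  rw [embed_eq_vacuumCoeff hδ hn hh h0 hq0 hq hp, ha, map_zero, map_zero, map_zero]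

lemma injective_embed_mul_iff (hδ : IsCoaction δA) (hn : 1 ≤ n) (hq0 : (q : ℂ) ≠ 0)
    (hq : (q : ℂ) - (q : ℂ)⁻¹ ≠ 0) {p : ℂ} (hp : p ≠ 0) :
    Function.Injective (embed δA hn (qnum q (p * q))) ↔
      Function.Injective (embed δA hn (qnum q p)) := by
  refine ⟨injective_embed_of_mul hδ hn hq0 hq hp, fun hinj => ?_⟩
  rw [← qnum_neg_inv]
  refine injective_embed_of_mul hδ hn hq0 hq (by simp [hp, hq0]) ?_
  rwa [show -(p * q)⁻¹ * (q : ℂ) = -p⁻¹ by field_simp, qnum_neg_inv]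

lemma injective_embed_mul_zpow_iff (hδ : IsCoaction δA) (hn : 1 ≤ n) (hq0 : (q : ℂ) ≠ 0)
    (hq : (q : ℂ) - (q : ℂ)⁻¹ ≠ 0) {p : ℂ} (hp : p ≠ 0) (m : ℤ) :
    Function.Injective (embed δA hn (qnum q (p * (q : ℂ) ^ m))) ↔
      Function.Injective (embed δA hn (qnum q p)) := by
  induction m using Int.induction_on with
  | zero => simp
  | succ m ih =>
    rw [← ih, zpow_add_one₀ hq0, ← mul_assoc]
    exact injective_embed_mul_iff hδ hn hq0 hq (mul_ne_zero hp (zpow_ne_zero _ hq0))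
  | pred m ih =>
    rw [← ih, ← injective_embed_mul_iff hδ hn hq0 hq (mul_ne_zero hp (zpow_ne_zero _ hq0)),
      mul_assoc, ← zpow_add_one₀ hq0, sub_add_cancel]

lemma adjoin_eq_range {τ : ℝ} {π : Aalg q n →ₐ[ℂ] Uq q (2 * n)}
    (hπγ : ∀ i, 1 ≤ i → i ≤ 2 * n → π (aγ q n i) = Cc q n i ∧ π (aγi q n i) = Ccinv q n i)
    (hπβ : ∀ j, 1 ≤ j → j + 1 ≤ 2 * n → j ≠ n → π (aβ q n j) = Bb q n j)
    (hπn : π (aβ q n n) = Bs q τ n) : Algebra.adjoin ℂ (ASet q τ n) = π.range := by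
  refine le_antisymm (Algebra.adjoin_le ?_) ?_
  · rintro z (⟨i, hi, hi', rfl | rfl⟩ | ⟨j, hj, hj', hjn, rfl⟩ | rfl)
    · exact ⟨_, (hπγ i hi hi').1⟩
    · exact ⟨_, (hπγ i hi hi').2⟩
    · exact ⟨_, hπβ j hj hj' hjn⟩
    · exact ⟨_, hπn⟩
  · rintro _ ⟨a, rfl⟩
    change π a ∈ _
    induction a using Aalg.induction with
    | hc c => rw [AlgHom.commutes]; exact Subalgebra.algebraMap_mem _ c
    | hγ i hi hi' =>
      rw [(hπγ i hi hi').1]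
      exact Algebra.subset_adjoin (Or.inl ⟨i, hi, hi', Or.inl rfl⟩)
    | hγi i hi hi' =>
      rw [(hπγ i hi hi').2]
      exact Algebra.subset_adjoin (Or.inl ⟨i, hi, hi', Or.inr rfl⟩)
    | hβ j hj hj' =>
      by_cases hjn : j = n
      · rw [hjn, hπn]
        exact Algebra.subset_adjoin (Or.inr (Or.inr rfl))
      · rw [hπβ j hj hj' hjn]
        exact Algebra.subset_adjoin (Or.inr (Or.inl ⟨j, hj, hj', hjn, rfl⟩))
    | hadd a b ha hb => rw [map_add]; exact add_mem ha hb
    | hmul a b ha hb => rw [map_mul]; exact mul_mem ha hb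

lemma embed_eq {τ : ℝ} {π : Aalg q n →ₐ[ℂ] Uq q (2 * n)} (hδ : IsCoaction δA) (hn : 1 ≤ n)
    (hπγ : ∀ i, 1 ≤ i → i ≤ 2 * n → π (aγ q n i) = Cc q n i ∧ π (aγi q n i) = Ccinv q n i)
    (hπβ : ∀ j, 1 ≤ j → j + 1 ≤ 2 * n → j ≠ n → π (aβ q n j) = Bb q n j)
    (hπn : π (aβ q n n) = Bs q τ n) :
    embed δA hn (((q ^ (-τ) - q ^ τ) / (q - q⁻¹) : ℝ) : ℂ) = π := by
  refine Aalg.hom_ext (fun i hi hi' => ?_) (fun i hi hi' => ?_) (fun j hj hj' => ?_)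
  · rw [embed_aγ hδ hn _ hi hi', (hπγ i hi hi').1]
  · rw [embed_aγi hδ hn _ hi hi', (hπγ i hi hi').2]
  · rw [embed_aβ hδ hn _ hj hj']
    split_ifs with hjn
    · subst hjn
      rw [hπn, Bs, Bb, show 2 * j - j = j by omega, ← pow_two, add_comm]
    · rw [zero_smul, zero_add, hπβ j hj hj' hjn]

lemma qnum_rpow (hq : 0 < q) (τ : ℝ) :
    qnum q ((q ^ (-τ) : ℝ) : ℂ) = (((q ^ (-τ) - q ^ τ) / (q - q⁻¹) : ℝ) : ℂ) := by
  rw [qnum, ← Complex.ofReal_inv, ← Real.rpow_neg hq.le, neg_neg]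
  push_cast
  rfl

/-- Two injective homomorphisms yield an isomorphism of their ranges. -/
lemma exists_algEquiv_of_injective {A B : Type*} [Ring A] [Ring B] [Algebra ℂ A] [Algebra ℂ B]
    {f g : A →ₐ[ℂ] B} (hf : Function.Injective f) (hg : Function.Injective g)
    {S T : Subalgebra ℂ B} (hS : S = f.range) (hT : T = g.range) :
    ∃ ζ : S ≃ₐ[ℂ] T, ∀ (x : S) (a : A), (x : B) = f a → (ζ x : B) = g a := by
  subst hS hT
  refine ⟨(AlgEquiv.ofInjective f hf).symm.trans (AlgEquiv.ofInjective g hg), fun x a hx => ?_⟩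
  have : x = AlgEquiv.ofInjective f hf a := Subtype.ext hx
  rw [this, AlgEquiv.trans_apply, AlgEquiv.symm_apply_apply]
  rfl

end Shift
end QG

open QG TensorProduct in
open scoped TensorProduct in
/-- (a) The assignment `γ_i^{±1} ↦ 1`, `β_j ↦ 0` (`j ≠ n`),
`β_n ↦ (q^{−σ−2k} − q^{σ+2k})/(q − q⁻¹)` extends to a character `χ : 𝒜 → ℂ`.
(b) `(χ ⊗ id) ∘ δ_𝒜 = π_{σ+2k}`; consequently `π_{σ+2k} ∘ π_σ⁻¹ : 𝒜_σ → 𝒜_{σ+2k}` is an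
algebra isomorphism fixing the `C_i^{±1}` and the `B_j` (`j ≠ n`) and sending `B_n^σ`
to `B_n^{σ+2k}`. -/
theorem statement_16 (q : ℝ) (hq0 : 0 < q) (hq1 : q < 1) (n : ℕ) (hn : 1 ≤ n)
    (σ : ℝ) (k : ℤ)
    (δA : Aalg q n →ₐ[ℂ] (Aalg q n ⊗[ℂ] Uq q (2*n)))
    (hδγ : ∀ i, 1 ≤ i → i ≤ 2*n →
      δA (aγ q n i) = aγ q n i ⊗ₜ[ℂ] (uK q (2*n) i * uK q (2*n) (2*n+1-i)) ∧
      δA (aγi q n i) = aγi q n i ⊗ₜ[ℂ] (uKi q (2*n) i * uKi q (2*n) (2*n+1-i)))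
    (hδβ : ∀ j, 1 ≤ j → j + 1 ≤ 2*n →
      δA (aβ q n j) =
        aβ q n j ⊗ₜ[ℂ] (uKi q (2*n) j * uKi q (2*n) (2*n-j))
        + aγi q n (j+1) ⊗ₜ[ℂ] (uF q (2*n) j * uKi q (2*n) (j+1) * uKi q (2*n) (2*n-j))
        + aγi q n j ⊗ₜ[ℂ] (uKi q (2*n) j * uE q (2*n) (2*n-j) * uKi q (2*n) (2*n-j)))
    (πσ : Aalg q n →ₐ[ℂ] Uq q (2*n))
    (hπσγ : ∀ i, 1 ≤ i → i ≤ 2*n →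
      πσ (aγ q n i) = Cc q n i ∧ πσ (aγi q n i) = Ccinv q n i)
    (hπσβ : ∀ j, 1 ≤ j → j + 1 ≤ 2*n → j ≠ n → πσ (aβ q n j) = Bb q n j)
    (hπσn : πσ (aβ q n n) = Bs q σ n) (hπσinj : Function.Injective πσ)
    (π' : Aalg q n →ₐ[ℂ] Uq q (2*n))
    (hπ'γ : ∀ i, 1 ≤ i → i ≤ 2*n →
      π' (aγ q n i) = Cc q n i ∧ π' (aγi q n i) = Ccinv q n i)
    (hπ'β : ∀ j, 1 ≤ j → j + 1 ≤ 2*n → j ≠ n → π' (aβ q n j) = Bb q n j)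
    (hπ'n : π' (aβ q n n) = Bs q (σ + 2*(k:ℝ)) n) :
    ∃ χ : Aalg q n →ₐ[ℂ] ℂ,
      (∀ i, 1 ≤ i → i ≤ 2*n → χ (aγ q n i) = 1 ∧ χ (aγi q n i) = 1) ∧
      (∀ j, 1 ≤ j → j + 1 ≤ 2*n → j ≠ n → χ (aβ q n j) = 0) ∧
      χ (aβ q n n) =
        (((q ^ (-σ - 2*(k:ℝ)) - q ^ (σ + 2*(k:ℝ))) / (q - q⁻¹) : ℝ) : ℂ) ∧
      (Algebra.TensorProduct.lid ℂ (Uq q (2*n))).toAlgHom.comp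
          ((Algebra.TensorProduct.map χ (AlgHom.id ℂ (Uq q (2*n)))).comp δA) = π' ∧
      ∃ ζ : ↥(Algebra.adjoin ℂ (ASet q σ n)) ≃ₐ[ℂ]
            ↥(Algebra.adjoin ℂ (ASet q (σ + 2*(k:ℝ)) n)),
        (∀ (x : ↥(Algebra.adjoin ℂ (ASet q σ n))) (a : Aalg q n),
          (x : Uq q (2*n)) = πσ a → ((ζ x : Uq q (2*n))) = π' a) ∧
        (∀ (x : ↥(Algebra.adjoin ℂ (ASet q σ n))),
          (∀ i, 1 ≤ i → i ≤ 2*n →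
            (((x : Uq q (2*n)) = Cc q n i → (ζ x : Uq q (2*n)) = Cc q n i) ∧
             ((x : Uq q (2*n)) = Ccinv q n i → (ζ x : Uq q (2*n)) = Ccinv q n i))) ∧
          (∀ j, 1 ≤ j → j + 1 ≤ 2*n → j ≠ n →
            ((x : Uq q (2*n)) = Bb q n j → (ζ x : Uq q (2*n)) = Bb q n j)) ∧
          ((x : Uq q (2*n)) = Bs q σ n →
            (ζ x : Uq q (2*n)) = Bs q (σ + 2*(k:ℝ)) n)) := by
  have hδ : IsCoaction δA := ⟨hδγ, hδβ⟩
  have hq0' : (q : ℂ) ≠ 0 := by exact_mod_cast hq0.ne'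
  have hq : (q : ℂ) - (q : ℂ)⁻¹ ≠ 0 := by
    have : q - q⁻¹ < 0 := sub_neg.2 (hq1.trans ((one_lt_inv₀ hq0).2 hq1))
    exact_mod_cast this.ne
  have eσ := embed_eq hδ hn hπσγ hπσβ hπσn
  have e' := embed_eq hδ hn hπ'γ hπ'β hπ'n
  have hp : (q : ℝ) ^ (-(σ + 2 * (k : ℝ))) = q ^ (-σ) * q ^ (-(2 * k) : ℤ) := by
    rw [← Real.rpow_intCast, ← Real.rpow_add hq0]
    push_cast
    ring_nf
  have hinj : Function.Injective π' := by
    rw [← e', ← qnum_rpow hq0, hp, Complex.ofReal_mul, Complex.ofReal_zpow,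
      injective_embed_mul_zpow_iff hδ hn hq0' hq
        (by exact_mod_cast (Real.rpow_pos_of_pos hq0 _).ne'), qnum_rpow hq0, eσ]
    exact hπσinj
  obtain ⟨ζ, hζ⟩ := exists_algEquiv_of_injective hπσinj hinj
    (adjoin_eq_range hπσγ hπσβ hπσn) (adjoin_eq_range hπ'γ hπ'β hπ'n)
  refine ⟨character q hn _, fun i _ _ => ⟨character_aγ hn _ i, character_aγi hn _ i⟩,
    fun j _ _ hjn => by rw [character_aβ, if_neg hjn], ?_, e', ζ, hζ,
    fun x => ⟨fun i hi hi' => ⟨fun hx => ?_, fun hx => ?_⟩, fun j hj hj' hjn hx => ?_,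
      fun hx => ?_⟩⟩
  · rw [character_aβ, if_pos rfl, neg_add']
  · rw [hζ x (aγ q n i) (by rw [hx, (hπσγ i hi hi').1]), (hπ'γ i hi hi').1]
  · rw [hζ x (aγi q n i) (by rw [hx, (hπσγ i hi hi').2]), (hπ'γ i hi hi').2]
  · rw [hζ x (aβ q n j) (by rw [hx, hπσβ j hj hj' hjn]), hπ'β j hj hj' hjn]
  · rw [hζ x (aβ q n n) (by rw [hx, hπσn]), hπ'n]
end

section
/- (a) The formulas K_r^{±1} v_j = q^{±δ(r,j)} v_j, x_i v_j = δ(i+1,j) v_{j−1}, y_i v_j = δ(i,j) v_{j+1} define a representation of U_q(g) on V (the vector representation), and the formulas K_r^{±1} v_j* = q^{∓δ(r,j)} v_j*, x_i v_j* = −q^{-1} δ(i,j) v_{j+1}*, y_i v_j* = −q δ(i+1,j) v_{j−1}* define a representation of U_q(g) on V* (the dual vector representation). (b) Fix σ ∈ ℝ. For s ∈ ℝ∖{0} put w_i(s) = v_i + s^{-1} v_{2n+1−i} and w_i*(s) = v_i* + s^{-1} q^{2i−2n−1} v_{2n+1−i}* (1 ≤ i ≤ n), W(s) = span{w_1(s),…,w_n(s)},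 W*(s) = span{w_1*(s),…,w_n*(s)}. Then W(q^σ) and W(−q^{−σ}) are invariant under all elements of 𝒜_σ, they are simple and mutually non-isomorphic as 𝒜_σ-modules, and V = W(q^σ) ⊕ W(−q^{−σ}); likewise W*(q^σ) and W*(−q^{−σ}) are 𝒜_σ-invariant, simple and mutually non-isomorphic, and V* = W*(q^σ) ⊕ W*(−q^{−σ}). -/
namespace QG

/-- The basis vector `v_j` of `V = ℂ^{2n}` (1-based, with `v_0 = v_{2n+1} = 0`). -/
noncomputable def vb (n : ℕ) (j : ℕ) : Fin (2*n) → ℂ :=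
  if h : 1 ≤ j ∧ j ≤ 2*n then Pi.single (⟨j-1, by omega⟩ : Fin (2*n)) 1 else 0

/-- `w_i(s) = v_i + s⁻¹ v_{2n+1-i}`. -/
noncomputable def wv (n : ℕ) (s : ℝ) (i : ℕ) : Fin (2*n) → ℂ :=
  vb n i + ((s : ℂ)⁻¹) • vb n (2*n+1-i)

/-- `w_i^*(s) = v_i^* + s⁻¹ q^{2i-2n-1} v_{2n+1-i}^*`. -/
noncomputable def wvs (q : ℝ) (n : ℕ) (s : ℝ) (i : ℕ) : Fin (2*n) → ℂ :=
  vb n i + ((s : ℂ)⁻¹ * (q : ℂ) ^ (2*(i:ℤ) - 2*(n:ℤ) - 1)) • vb n (2*n+1-i)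

/-- `W(s) = span{w_1(s),…,w_n(s)}`. -/
noncomputable def Wsub (n : ℕ) (s : ℝ) : Submodule ℂ (Fin (2*n) → ℂ) :=
  Submodule.span ℂ {w | ∃ i, 1 ≤ i ∧ i ≤ n ∧ w = wv n s i}

/-- `W^*(s) = span{w_1^*(s),…,w_n^*(s)}`. -/
noncomputable def Wssub (q : ℝ) (n : ℕ) (s : ℝ) : Submodule ℂ (Fin (2*n) → ℂ) :=
  Submodule.span ℂ {w | ∃ i, 1 ≤ i ∧ i ≤ n ∧ w = wvs q n s i}

/-- Invariance of a subspace under the subalgebra `𝒜_σ`. -/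
def AInv (q σ : ℝ) (n : ℕ) (ρ : Uq q (2*n) →ₐ[ℂ] Module.End ℂ (Fin (2*n) → ℂ))
    (p : Submodule ℂ (Fin (2*n) → ℂ)) : Prop :=
  ∀ z ∈ Algebra.adjoin ℂ (ASet q σ n), ∀ w ∈ p, ρ z w ∈ p

/-- Simplicity of an `𝒜_σ`-invariant subspace `W` as an `𝒜_σ`-module. -/
def ASimple (q σ : ℝ) (n : ℕ) (ρ : Uq q (2*n) →ₐ[ℂ] Module.End ℂ (Fin (2*n) → ℂ))
    (W : Submodule ℂ (Fin (2*n) → ℂ)) : Prop :=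
  W ≠ ⊥ ∧ ∀ p : Submodule ℂ (Fin (2*n) → ℂ), p ≤ W → AInv q σ n ρ p → p = ⊥ ∨ p = W

/-- Isomorphism of two `𝒜_σ`-invariant subspaces as `𝒜_σ`-modules. -/
def AIso (q σ : ℝ) (n : ℕ) (ρ : Uq q (2*n) →ₐ[ℂ] Module.End ℂ (Fin (2*n) → ℂ))
    (W1 W2 : Submodule ℂ (Fin (2*n) → ℂ)) : Prop :=
  ∃ e : ↥W1 ≃ₗ[ℂ] ↥W2, ∀ z ∈ Algebra.adjoin ℂ (ASet q σ n),
    ∀ (w : ↥W1) (h : ρ z (w : Fin (2*n) → ℂ) ∈ W1),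
      (e ⟨ρ z (w : Fin (2*n) → ℂ), h⟩ : Fin (2*n) → ℂ)
        = ρ z ((e w : Fin (2*n) → ℂ))

end QG


namespace QG

open Module

section MatrixUnits

variable {m : ℕ}

/-- The diagonal operator `v_k ↦ f k • v_k`. -/
def diagOp (m : ℕ) (f : ℕ → ℂ) : End ℂ (Fin m → ℂ) where
  toFun u i := f (i + 1) * u i
  map_add' u v := by ext i; simp [mul_add]
  map_smul' c u := by ext i; simp [mul_left_comm]

/-- The matrix unit `v_a ↦ v_b` (1-based; zero if an index is out of range). -/
def unitOp (m a b : ℕ) : End ℂ (Fin m → ℂ) where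
  toFun u i := if h : 1 ≤ a ∧ a ≤ m ∧ (i : ℕ) + 1 = b then u ⟨a - 1, by omega⟩ else 0
  map_add' u v := by ext i; by_cases h : 1 ≤ a ∧ a ≤ m ∧ (i : ℕ) + 1 = b <;> simp [h]
  map_smul' c u := by ext i; by_cases h : 1 ≤ a ∧ a ≤ m ∧ (i : ℕ) + 1 = b <;> simp [h]

theorem diagOp_apply (f : ℕ → ℂ) (u : Fin m → ℂ) (i : Fin m) :
    diagOp m f u i = f (i + 1) * u i := rfl

theorem unitOp_apply (a b : ℕ) (u : Fin m → ℂ) (i : Fin m) :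
    unitOp m a b u i =
      if h : 1 ≤ a ∧ a ≤ m ∧ (i : ℕ) + 1 = b then u ⟨a - 1, by omega⟩ else 0 := rfl

theorem unitOp_self_apply (a : ℕ) (u : Fin m → ℂ) (i : Fin m) :
    unitOp m a a u i = if (i : ℕ) + 1 = a then u i else 0 := by
  rw [unitOp_apply]
  split_ifs with h1 h2 h2
  · simp [← h2]
  · exact absurd h1.2.2 h2
  · omega
  · rfl

theorem diagOp_mul_diagOp (f g : ℕ → ℂ) :
    diagOp m f * diagOp m g = diagOp m (fun k => f k * g k) := by
  refine LinearMap.ext fun u => funext fun i => ?_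
  simp [diagOp_apply, mul_assoc]

theorem diagOp_eq_one {f : ℕ → ℂ} (h : ∀ k, 1 ≤ k → k ≤ m → f k = 1) : diagOp m f = 1 := by
  refine LinearMap.ext fun u => funext fun i => ?_
  simp [diagOp_apply, h (i + 1) (by omega) (by omega)]

theorem diagOp_mul_unitOp (f : ℕ → ℂ) (a b : ℕ) :
    diagOp m f * unitOp m a b = f b • unitOp m a b := by
  refine LinearMap.ext fun u => funext fun i => ?_
  by_cases h : 1 ≤ a ∧ a ≤ m ∧ (i : ℕ) + 1 = b
  · simp [diagOp_apply, unitOp_apply, h]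
  · simp [diagOp_apply, unitOp_apply, h]

theorem unitOp_mul_diagOp (f : ℕ → ℂ) (a b : ℕ) :
    unitOp m a b * diagOp m f = f a • unitOp m a b := by
  refine LinearMap.ext fun u => funext fun i => ?_
  by_cases h : 1 ≤ a ∧ a ≤ m ∧ (i : ℕ) + 1 = b
  · simp [diagOp_apply, unitOp_apply, h]
  · simp [unitOp_apply, h]

theorem unitOp_mul_unitOp (a b c d : ℕ) :
    unitOp m a b * unitOp m c d =
      if d = a ∧ 1 ≤ a ∧ a ≤ m then unitOp m c b else 0 := by
  refine LinearMap.ext fun u => funext fun i => ?_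
  split_ifs with h
  · obtain ⟨rfl, h1, h2⟩ := h
    simp only [Module.End.mul_apply, unitOp_apply]
    split_ifs <;> first | rfl | (simp at *; omega)
  · simp only [Module.End.mul_apply, unitOp_apply]
    split_ifs <;> first | rfl | (simp at *; omega)

theorem unitOp_eq_zero {a b : ℕ} (h : ¬ (1 ≤ a ∧ a ≤ m ∧ 1 ≤ b ∧ b ≤ m)) :
    unitOp m a b = 0 := by
  refine LinearMap.ext fun u => funext fun i => ?_
  rw [unitOp_apply, dif_neg (by omega)]
  rfl

theorem diagOp_vb {n : ℕ} (f : ℕ → ℂ) (j : ℕ) :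
    diagOp (2 * n) f (vb n j) = f j • vb n j := by
  ext i
  unfold vb
  split_ifs with h
  · simp only [diagOp_apply, Pi.smul_apply, Pi.single_apply, Fin.ext_iff]
    split_ifs with h'
    · simp [h', Nat.sub_add_cancel h.1]
    · simp
  · simp

theorem unitOp_vb {n a b j : ℕ} (hj : 1 ≤ j) (hj' : j ≤ 2 * n) :
    unitOp (2 * n) a b (vb n j) = if a = j then vb n b else 0 := by
  ext i
  by_cases hb : 1 ≤ b ∧ b ≤ 2 * n <;>
    simp only [unitOp_apply, vb, hb, hj, hj', dif_pos, dif_neg, not_false_eq_true,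
      Pi.single_apply, Fin.ext_iff, and_self] <;> split_ifs <;>
    simp_all [Pi.single_apply, Fin.ext_iff] <;> omega

end MatrixUnits

/-- Candidate actions of the generators: `K_r` acts by `v_k ↦ κ^{δ(r,k)} v_k`, `E_i` by
`v_{a i} ↦ α v_{b i}` and `F_i` by `v_{b i} ↦ β v_{a i}`. -/
noncomputable def genAction (m : ℕ) (κ α β : ℂ) (a b : ℕ → ℕ) : Gen → End ℂ (Fin m → ℂ)
  | .K r => diagOp m fun k => κ ^ kd r k
  | .Ki r => diagOp m fun k => κ ^ (-kd r k)
  | .E i => α • unitOp m (a i) (b i)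
  | .F i => β • unitOp m (b i) (a i)

theorem lift_genAction_rel {q : ℝ} (hq0 : 0 < q) (hq1 : q < 1) {m : ℕ} {κ α β : ℂ}
    {a b : ℕ → ℕ} (hαβ : α * β = 1)
    (h : (a = (fun i => i + 1) ∧ b = (fun i => i) ∧ κ = q) ∨
      (a = (fun i => i) ∧ b = (fun i => i + 1) ∧ κ = (q : ℂ)⁻¹)) ⦃x y : FA⦄ (hxy : Rel q m x y) :
    FreeAlgebra.lift ℂ (genAction m κ α β a b) x = FreeAlgebra.lift ℂ (genAction m κ α β a b) y := by
  have hq : (q : ℂ) ≠ 0 := by exact_mod_cast hq0.ne'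
  have hqq : (q : ℂ) - (q : ℂ)⁻¹ ≠ 0 := by
    have : q - q⁻¹ ≠ 0 := by
      have := one_lt_inv_iff₀.2 ⟨hq0, hq1⟩
      linarith
    exact_mod_cast this
  have hκ : κ ≠ 0 := by rcases h with ⟨-, -, rfl⟩ | ⟨-, -, rfl⟩ <;> simp [hq]
  have hβα : β * α = 1 := by rw [mul_comm, hαβ]
  cases hxy with
  | Kout i hi =>
    simp only [fK, FreeAlgebra.lift_ι_apply, genAction, map_one]
    exact diagOp_eq_one fun k h1 h2 => by rw [kd, if_neg (by omega), zpow_zero]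
  | Kiout i hi =>
    simp only [fKi, FreeAlgebra.lift_ι_apply, genAction, map_one]
    exact diagOp_eq_one fun k h1 h2 => by rw [kd, if_neg (by omega), neg_zero, zpow_zero]
  | Eout j hj =>
    simp only [fE, FreeAlgebra.lift_ι_apply, genAction, map_zero]
    rw [unitOp_eq_zero, smul_zero]
    rcases h with ⟨rfl, rfl, -⟩ | ⟨rfl, rfl, -⟩ <;> dsimp only <;> omega
  | Fout j hj =>
    simp only [fF, FreeAlgebra.lift_ι_apply, genAction, map_zero]
    rw [unitOp_eq_zero, smul_zero]
    rcases h with ⟨rfl, rfl, -⟩ | ⟨rfl, rfl, -⟩ <;> dsimp only <;> omega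
  | KK i j =>
    simp only [fK, map_mul, FreeAlgebra.lift_ι_apply, genAction, diagOp_mul_diagOp, mul_comm]
  | KKi i =>
    simp only [fK, fKi, map_mul, FreeAlgebra.lift_ι_apply, genAction, diagOp_mul_diagOp, map_one]
    exact diagOp_eq_one fun k _ _ => by rw [← zpow_add₀ hκ, add_neg_cancel, zpow_zero]
  | KiK i =>
    simp only [fK, fKi, map_mul, FreeAlgebra.lift_ι_apply, genAction, diagOp_mul_diagOp, map_one]
    exact diagOp_eq_one fun k _ _ => by rw [← zpow_add₀ hκ, neg_add_cancel, zpow_zero]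
  | KE i j =>
    simp only [fK, fE, map_mul, map_smul, FreeAlgebra.lift_ι_apply, genAction,
      mul_smul_comm, smul_mul_assoc, diagOp_mul_unitOp, unitOp_mul_diagOp, smul_smul]
    congr 1
    rcases h with ⟨rfl, rfl, rfl⟩ | ⟨rfl, rfl, rfl⟩ <;>
      simp only [inv_zpow', zpow_sub₀ hq, zpow_neg] <;> field_simp
  | KF i j =>
    simp only [fK, fF, map_mul, map_smul, FreeAlgebra.lift_ι_apply, genAction,
      mul_smul_comm, smul_mul_assoc, diagOp_mul_unitOp, unitOp_mul_diagOp, smul_smul]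
    congr 1
    rcases h with ⟨rfl, rfl, rfl⟩ | ⟨rfl, rfl, rfl⟩ <;>
      simp only [inv_zpow', zpow_sub₀ hq, zpow_neg] <;> field_simp
  | EF i j hi hi' hj hj' =>
    simp only [fE, fF, map_mul, map_sub, FreeAlgebra.lift_ι_apply, genAction,
      mul_smul_comm, smul_mul_assoc, unitOp_mul_unitOp, smul_smul, hαβ, hβα, one_smul]
    by_cases hij : i = j
    · subst hij
      refine LinearMap.ext fun u => funext fun k => ?_
      have hr : 1 ≤ a i ∧ a i ≤ m ∧ 1 ≤ b i ∧ b i ≤ m := by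
        rcases h with ⟨rfl, rfl, -⟩ | ⟨rfl, rfl, -⟩ <;> dsimp only <;> omega
      simp only [fK, fKi, map_smul, map_sub, map_mul, FreeAlgebra.lift_ι_apply, genAction,
        diagOp_mul_diagOp, hr, and_self, if_true, LinearMap.sub_apply, LinearMap.smul_apply,
        Pi.sub_apply, Pi.smul_apply, smul_eq_mul, unitOp_self_apply, diagOp_apply]
      have key : ∀ z : ℂ, z = ((q : ℂ) - (q : ℂ)⁻¹)⁻¹ * (q * z - (q : ℂ)⁻¹ * z) := fun z => by
        rw [← sub_mul, inv_mul_cancel_left₀ hqq]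
      have key' : ∀ z : ℂ, -z = ((q : ℂ) - (q : ℂ)⁻¹)⁻¹ * ((q : ℂ)⁻¹ * z - q * z) := fun z => by
        rw [← sub_mul, ← neg_sub (q : ℂ), neg_mul, mul_neg, inv_mul_cancel_left₀ hqq]
      have h3 : ¬ i = i + 1 := by omega
      have h4 : ¬ i + 1 = i := by omega
      simp only [kd, @eq_comm ℕ i, @eq_comm ℕ (i + 1)]
      rcases h with ⟨rfl, rfl, rfl⟩ | ⟨rfl, rfl, rfl⟩ <;> by_cases h1 : (k : ℕ) + 1 = i <;>
        by_cases h2 : (k : ℕ) + 1 = i + 1 <;> first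
        | omega
        | simp only [h1, h2, h3, h4, if_true, if_false, zpow_one, zpow_neg, zpow_zero, mul_one,
            one_mul, sub_zero, zero_sub, neg_zero, sub_self, mul_zero, inv_inv, ← key, ← key']
    · rw [if_neg hij, if_neg, if_neg, sub_zero, map_zero] <;>
      rcases h with ⟨rfl, rfl, -⟩ | ⟨rfl, rfl, -⟩ <;> dsimp only <;> omega
  | EE i j hi hi' hj hj' hij =>
    simp only [fE, map_mul, FreeAlgebra.lift_ι_apply, genAction,
      mul_smul_comm, smul_mul_assoc, unitOp_mul_unitOp]
    rw [if_neg, if_neg] <;>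
    rcases h with ⟨rfl, rfl, -⟩ | ⟨rfl, rfl, -⟩ <;> dsimp only <;> omega
  | FF i j hi hi' hj hj' hij =>
    simp only [fF, map_mul, FreeAlgebra.lift_ι_apply, genAction,
      mul_smul_comm, smul_mul_assoc, unitOp_mul_unitOp]
    rw [if_neg, if_neg] <;>
    rcases h with ⟨rfl, rfl, -⟩ | ⟨rfl, rfl, -⟩ <;> dsimp only <;> omega
  | Eserre i j hi hi' hj hj' hij =>
    have h1 : unitOp m (a i) (b i) * unitOp m (a i) (b i) = 0 := by
      rw [unitOp_mul_unitOp, if_neg]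
      rcases h with ⟨rfl, rfl, -⟩ | ⟨rfl, rfl, -⟩ <;> dsimp only <;> omega
    have h2 : unitOp m (a i) (b i) * unitOp m (a j) (b j) * unitOp m (a i) (b i) = 0 := by
      rw [unitOp_mul_unitOp]
      split_ifs with h'
      · rw [unitOp_mul_unitOp, if_neg]
        rcases h with ⟨rfl, rfl, -⟩ | ⟨rfl, rfl, -⟩ <;> dsimp only at * <;> omega
      · rw [zero_mul]
    simp only [fE, map_mul, map_sub, map_add, map_smul, FreeAlgebra.lift_ι_apply,
      genAction, map_zero, mul_smul_comm, smul_mul_assoc, pow_two, h1, h2]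
    simp
  | Fserre i j hi hi' hj hj' hij =>
    have h1 : unitOp m (b i) (a i) * unitOp m (b i) (a i) = 0 := by
      rw [unitOp_mul_unitOp, if_neg]
      rcases h with ⟨rfl, rfl, -⟩ | ⟨rfl, rfl, -⟩ <;> dsimp only <;> omega
    have h2 : unitOp m (b i) (a i) * unitOp m (b j) (a j) * unitOp m (b i) (a i) = 0 := by
      rw [unitOp_mul_unitOp]
      split_ifs with h'
      · rw [unitOp_mul_unitOp, if_neg]
        rcases h with ⟨rfl, rfl, -⟩ | ⟨rfl, rfl, -⟩ <;> dsimp only at * <;> omega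
      · rw [zero_mul]
    simp only [fF, map_mul, map_sub, map_add, map_smul, FreeAlgebra.lift_ι_apply,
      genAction, map_zero, mul_smul_comm, smul_mul_assoc, pow_two, h1, h2]
    simp

theorem exists_genAction_rep {q : ℝ} (hq0 : 0 < q) (hq1 : q < 1) {n : ℕ} {κ α β : ℂ}
    {a b : ℕ → ℕ} (hαβ : α * β = 1)
    (h : (a = (fun i => i + 1) ∧ b = (fun i => i) ∧ κ = q) ∨
      (a = (fun i => i) ∧ b = (fun i => i + 1) ∧ κ = (q : ℂ)⁻¹)) :
    ∃ ρ : Uq q (2 * n) →ₐ[ℂ] End ℂ (Fin (2 * n) → ℂ),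
      (∀ r j, ρ (uK q (2 * n) r) (vb n j) = κ ^ kd r j • vb n j) ∧
      (∀ r j, ρ (uKi q (2 * n) r) (vb n j) = κ ^ (-kd r j) • vb n j) ∧
      (∀ i j, 1 ≤ j → j ≤ 2 * n →
        ρ (uE q (2 * n) i) (vb n j) = if a i = j then α • vb n (b i) else 0) ∧
      (∀ i j, 1 ≤ j → j ≤ 2 * n →
        ρ (uF q (2 * n) i) (vb n j) = if b i = j then β • vb n (a i) else 0) := by
  refine ⟨RingQuot.liftAlgHom ℂ
    ⟨FreeAlgebra.lift ℂ (genAction (2 * n) κ α β a b), lift_genAction_rel hq0 hq1 hαβ h⟩,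
    fun r j => ?_, fun r j => ?_, fun i j hj hj' => ?_, fun i j hj hj' => ?_⟩
  · rw [uK, RingQuot.liftAlgHom_mkAlgHom_apply, fK, FreeAlgebra.lift_ι_apply, genAction, diagOp_vb]
  · rw [uKi, RingQuot.liftAlgHom_mkAlgHom_apply, fKi, FreeAlgebra.lift_ι_apply, genAction,
      diagOp_vb]
  · rw [uE, RingQuot.liftAlgHom_mkAlgHom_apply, fE, FreeAlgebra.lift_ι_apply, genAction,
      LinearMap.smul_apply, unitOp_vb hj hj', smul_ite, smul_zero]
  · rw [uF, RingQuot.liftAlgHom_mkAlgHom_apply, fF, FreeAlgebra.lift_ι_apply, genAction,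
      LinearMap.smul_apply, unitOp_vb hj hj', smul_ite, smul_zero]

theorem vb_eq_zero {n j : ℕ} (h : ¬ (1 ≤ j ∧ j ≤ 2 * n)) : vb n j = 0 := dif_neg h

theorem kd_self (i : ℕ) : kd i i = 1 := if_pos rfl

theorem kd_of_ne {i j : ℕ} (h : i ≠ j) : kd i j = 0 := if_neg h

theorem vb_apply_of_ne {n j : ℕ} {i : Fin (2 * n)} (h : j ≠ i + 1) : vb n j i = 0 := by
  unfold vb
  split_ifs with hj
  · exact Pi.single_eq_of_ne (fun e => h (by simp [e]; omega)) _
  · rfl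

theorem eq_top_of_vb_mem {n : ℕ} {p : Submodule ℂ (Fin (2 * n) → ℂ)}
    (h : ∀ j, 1 ≤ j → j ≤ 2 * n → vb n j ∈ p) : p = ⊤ := by
  rw [eq_top_iff, ← (Pi.basisFun ℂ (Fin (2 * n))).span_eq, Submodule.span_le]
  rintro _ ⟨i, rfl⟩
  have := h (i + 1) (by omega) (by omega)
  rw [vb, dif_pos ⟨by omega, by omega⟩] at this
  simpa using this

/-- The span of `f 1, …, f n`. -/
def famSpan (n : ℕ) (f : ℕ → Fin (2 * n) → ℂ) : Submodule ℂ (Fin (2 * n) → ℂ) :=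
  Submodule.span ℂ {w | ∃ i, 1 ≤ i ∧ i ≤ n ∧ w = f i}

section famSpan

variable {n : ℕ} {f : ℕ → Fin (2 * n) → ℂ}

theorem mem_famSpan {i : ℕ} (hi : 1 ≤ i) (hi' : i ≤ n) : f i ∈ famSpan n f :=
  Submodule.subset_span ⟨i, hi, hi', rfl⟩

theorem famSpan_le {p : Submodule ℂ (Fin (2 * n) → ℂ)} :
    famSpan n f ≤ p ↔ ∀ i, 1 ≤ i → i ≤ n → f i ∈ p := by
  rw [famSpan, Submodule.span_le]
  exact ⟨fun h i hi hi' => h ⟨i, hi, hi', rfl⟩, fun h _ ⟨i, hi, hi', e⟩ => e ▸ h i hi hi'⟩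

theorem famSpan_eq_span_image :
    famSpan n f = Submodule.span ℂ (f '' (Finset.Icc 1 n : Finset ℕ)) := by
  rw [famSpan]
  congr 1
  ext w
  simp [and_assoc, eq_comm]

theorem exists_sum_of_mem_famSpan {u : Fin (2 * n) → ℂ} (hu : u ∈ famSpan n f) :
    ∃ x : ℕ → ℂ, ∑ k ∈ Finset.Icc 1 n, x k • f k = u := by
  rwa [famSpan_eq_span_image, Submodule.mem_span_image_finset_iff_exists_fun'] at hu

theorem finrank_famSpan_le : finrank ℂ (famSpan n f) ≤ n := by
  classical
  rw [famSpan_eq_span_image, ← Finset.coe_image]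
  refine (finrank_span_finset_le_card _).trans (Finset.card_image_le.trans ?_)
  simp

theorem famSpan_pair_isCompl {t t' : ℕ → ℂ}
    (ht : ∀ i, 1 ≤ i → i ≤ n → t i ≠ t' i) :
    famSpan n (fun i => vb n i + t i • vb n (2 * n + 1 - i)) ⊔
        famSpan n (fun i => vb n i + t' i • vb n (2 * n + 1 - i)) = ⊤ ∧
      famSpan n (fun i => vb n i + t i • vb n (2 * n + 1 - i)) ⊓
        famSpan n (fun i => vb n i + t' i • vb n (2 * n + 1 - i)) = ⊥ := by
  set p := famSpan n (fun i => vb n i + t i • vb n (2 * n + 1 - i)) with hp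
  set p' := famSpan n (fun i => vb n i + t' i • vb n (2 * n + 1 - i)) with hp'
  have hmem : ∀ i, 1 ≤ i → i ≤ n → vb n i ∈ p ⊔ p' ∧ vb n (2 * n + 1 - i) ∈ p ⊔ p' := by
    intro i hi hi'
    have h1 : vb n i + t i • vb n (2 * n + 1 - i) ∈ p ⊔ p' :=
      Submodule.mem_sup_left
        (mem_famSpan (f := fun i => vb n i + t i • vb n (2 * n + 1 - i)) hi hi')
    have h2 : vb n i + t' i • vb n (2 * n + 1 - i) ∈ p ⊔ p' :=
      Submodule.mem_sup_right
        (mem_famSpan (f := fun i => vb n i + t' i • vb n (2 * n + 1 - i)) hi hi')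
    have h3 : vb n (2 * n + 1 - i) ∈ p ⊔ p' := by
      refine (Submodule.smul_mem_iff _ (sub_ne_zero.2 (ht i hi hi'))).1 ?_
      convert Submodule.sub_mem _ h1 h2 using 1
      module
    refine ⟨?_, h3⟩
    simpa using Submodule.sub_mem _ h1 (Submodule.smul_mem _ (t i) h3)
  have htop : p ⊔ p' = ⊤ := by
    refine eq_top_of_vb_mem fun j hj hj' => ?_
    by_cases hjn : j ≤ n
    · exact (hmem j hj hjn).1
    · have := (hmem (2 * n + 1 - j) (by omega) (by omega)).2
      rwa [show 2 * n + 1 - (2 * n + 1 - j) = j by omega] at this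
  refine ⟨htop, ?_⟩
  have h := Submodule.finrank_sup_add_finrank_inf_eq p p'
  rw [htop, finrank_top, finrank_fin_fun] at h
  have h1 : finrank ℂ p ≤ n := finrank_famSpan_le
  have h2 : finrank ℂ p' ≤ n := finrank_famSpan_le
  exact Submodule.finrank_eq_zero.1 (by omega)

end famSpan

/-- A family `f 1, …, f n` of joint eigenvectors of the `C_i` and `B_n^σ`, with `B_n^σ`
acting by `μ` on `f n` and by `c` on the others, which is permuted up to scalars by the `B_j`. -/
structure IsWeightFamily (q σ : ℝ) (n : ℕ) (ρ : Uq q (2 * n) →ₐ[ℂ] End ℂ (Fin (2 * n) → ℂ))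
    (f : ℕ → Fin (2 * n) → ℂ) (a c μ : ℂ) : Prop where
  C_apply : ∀ i, 1 ≤ i → i ≤ 2 * n → ∀ k, 1 ≤ k → k ≤ n →
    ρ (Cc q n i) (f k) = (if i = k ∨ i + k = 2 * n + 1 then a else 1) • f k
  Cinv_apply : ∀ i, 1 ≤ i → i ≤ 2 * n → ∀ k, 1 ≤ k → k ≤ n →
    ρ (Ccinv q n i) (f k) = (if i = k ∨ i + k = 2 * n + 1 then a⁻¹ else 1) • f k
  B_mem : ∀ j, 1 ≤ j → j + 1 ≤ 2 * n → j ≠ n → ∀ k, 1 ≤ k → k ≤ n →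
    ρ (Bb q n j) (f k) ∈ famSpan n f
  raise : ∀ k, 1 ≤ k → k + 1 ≤ n → ∃ j d, 1 ≤ j ∧ j + 1 ≤ 2 * n ∧ j ≠ n ∧ d ≠ (0 : ℂ) ∧
    ρ (Bb q n j) (f k) = d • f (k + 1)
  lower : ∀ k, 1 ≤ k → k + 1 ≤ n → ∃ j d, 1 ≤ j ∧ j + 1 ≤ 2 * n ∧ j ≠ n ∧ d ≠ (0 : ℂ) ∧
    ρ (Bb q n j) (f (k + 1)) = d • f k
  Bs_apply : ∀ k, 1 ≤ k → k ≤ n → ρ (Bs q σ n) (f k) = (if k = n then μ else c) • f k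
  ne_zero : f n ≠ 0

theorem AInv_of_generators {q σ : ℝ} {n : ℕ} {ρ : Uq q (2 * n) →ₐ[ℂ] End ℂ (Fin (2 * n) → ℂ)}
    {p : Submodule ℂ (Fin (2 * n) → ℂ)} (h : ∀ z ∈ ASet q σ n, ∀ w ∈ p, ρ z w ∈ p) :
    AInv q σ n ρ p := by
  intro z hz
  induction hz using Algebra.adjoin_induction with
  | mem z hz => exact h z hz
  | algebraMap r =>
    intro w hw
    rw [AlgHom.commutes, Module.algebraMap_end_apply]
    exact p.smul_mem r hw
  | add x y _ _ hx hy =>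
    intro w hw
    rw [map_add]
    exact p.add_mem (hx w hw) (hy w hw)
  | mul x y _ _ hx hy =>
    intro w hw
    rw [map_mul]
    exact hx _ (hy w hw)

namespace IsWeightFamily

variable {q σ : ℝ} {n : ℕ} {ρ : Uq q (2 * n) →ₐ[ℂ] End ℂ (Fin (2 * n) → ℂ)}
  {f f' : ℕ → Fin (2 * n) → ℂ} {a c μ μ' : ℂ}

theorem aInv (hf : IsWeightFamily q σ n ρ f a c μ) : AInv q σ n ρ (famSpan n f) := by
  refine AInv_of_generators fun z hz => ?_
  suffices famSpan n f ≤ (famSpan n f).comap (ρ z) from fun w hw => this hw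
  refine famSpan_le.2 fun k hk hk' => ?_
  rw [Submodule.mem_comap]
  rcases hz with ⟨i, hi, hi', rfl | rfl⟩ | ⟨j, hj, hj', hjn, rfl⟩ | rfl
  · rw [hf.C_apply i hi hi' k hk hk']
    exact Submodule.smul_mem _ _ (mem_famSpan hk hk')
  · rw [hf.Cinv_apply i hi hi' k hk hk']
    exact Submodule.smul_mem _ _ (mem_famSpan hk hk')
  · exact hf.B_mem j hj hj' hjn k hk hk'
  · rw [hf.Bs_apply k hk hk']
    exact Submodule.smul_mem _ _ (mem_famSpan hk hk')

theorem aSimple (hf : IsWeightFamily q σ n ρ f a c μ) (hn : 1 ≤ n) (ha : a ≠ 1) :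
    ASimple q σ n ρ (famSpan n f) := by
  refine ⟨fun h => hf.ne_zero ?_, fun p hp hinv => ?_⟩
  · rw [← Submodule.mem_bot ℂ, ← h]
    exact mem_famSpan hn le_rfl
  rw [or_iff_not_imp_left]
  intro hbot
  obtain ⟨u, hup, hu0⟩ := p.ne_bot_iff.1 hbot
  obtain ⟨x, rfl⟩ := exists_sum_of_mem_famSpan (hp hup)
  obtain ⟨k, hk, hxk⟩ := Finset.exists_ne_zero_of_sum_ne_zero hu0
  rw [Finset.mem_Icc] at hk
  have hinv' : ∀ z ∈ ASet q σ n, ∀ w ∈ p, ρ z w ∈ p := fun z hz =>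
    hinv z (Algebra.subset_adjoin hz)
  have hfk : f k ∈ p := by
    have h1 := p.sub_mem
      (hinv' (Cc q n k) (Or.inl ⟨k, hk.1, by omega, Or.inl rfl⟩) _ hup) hup
    have h2 : ρ (Cc q n k) (∑ l ∈ Finset.Icc 1 n, x l • f l) - ∑ l ∈ Finset.Icc 1 n, x l • f l
        = ((a - 1) * x k) • f k := by
      rw [map_sum, ← Finset.sum_sub_distrib, Finset.sum_eq_single k]
      · rw [map_smul, hf.C_apply k hk.1 (by omega) k hk.1 hk.2, if_pos (Or.inl rfl)]
        module
      · intro l hl hlk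
        rw [Finset.mem_Icc] at hl
        rw [map_smul, hf.C_apply k hk.1 (by omega) l hl.1 hl.2, if_neg (by omega), one_smul,
          sub_self]
      · intro h
        exact absurd (Finset.mem_Icc.2 hk) h
    rw [h2] at h1
    exact (p.smul_mem_iff (mul_ne_zero (sub_ne_zero.2 ha) (left_ne_zero_of_smul hxk))).1 h1
  have hup : ∀ l, 1 ≤ l → l + 1 ≤ n → (f l ∈ p ↔ f (l + 1) ∈ p) := by
    intro l hl hl'
    constructor
    · intro h
      obtain ⟨j, d, hj, hj', hjn, hd, e⟩ := hf.raise l hl hl'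
      have := hinv' (Bb q n j) (Or.inr (Or.inl ⟨j, hj, hj', hjn, rfl⟩)) _ h
      rw [e] at this
      exact (p.smul_mem_iff hd).1 this
    · intro h
      obtain ⟨j, d, hj, hj', hjn, hd, e⟩ := hf.lower l hl hl'
      have := hinv' (Bb q n j) (Or.inr (Or.inl ⟨j, hj, hj', hjn, rfl⟩)) _ h
      rw [e] at this
      exact (p.smul_mem_iff hd).1 this
  have hone : ∀ l, 1 ≤ l → l ≤ n → (f l ∈ p ↔ f 1 ∈ p) := by
    intro l hl
    induction l, hl using Nat.le_induction with
    | base => exact fun _ => Iff.rfl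
    | succ l hl ih => exact fun h => (hup l hl h).symm.trans (ih (by omega))
  exact le_antisymm hp (famSpan_le.2 fun l hl hl' =>
    (hone l hl hl').2 ((hone k hk.1 hk.2).1 hfk))

theorem not_aIso (hf : IsWeightFamily q σ n ρ f a c μ) (hf' : IsWeightFamily q σ n ρ f' a c μ')
    (hn : 1 ≤ n) (hμ : μ ≠ μ') (hμc : μ ≠ c) : ¬ AIso q σ n ρ (famSpan n f) (famSpan n f') := by
  rintro ⟨e, he⟩
  have hBs : Bs q σ n ∈ Algebra.adjoin ℂ (ASet q σ n) :=
    Algebra.subset_adjoin (Or.inr (Or.inr rfl))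
  set w : famSpan n f := ⟨f n, mem_famSpan hn le_rfl⟩ with hw
  have hw0 : (e w : Fin (2 * n) → ℂ) ≠ 0 := by
    simpa [hw, Subtype.ext_iff] using hf.ne_zero
  have hBw : ρ (Bs q σ n) (w : Fin (2 * n) → ℂ) = μ • (w : Fin (2 * n) → ℂ) := by
    rw [hf.Bs_apply n hn le_rfl, if_pos rfl]
  have hmem : ρ (Bs q σ n) (w : Fin (2 * n) → ℂ) ∈ famSpan n f :=
    hBw ▸ Submodule.smul_mem _ _ w.2
  have h1 : (⟨_, hmem⟩ : famSpan n f) = μ • w := Subtype.ext hBw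
  have h2 : ρ (Bs q σ n) (e w : Fin (2 * n) → ℂ) = μ • (e w : Fin (2 * n) → ℂ) := by
    rw [← he _ hBs w hmem, h1, map_smul, Submodule.coe_smul]
  have h3 : ∀ u ∈ famSpan n f', ρ (Bs q σ n) u - c • u ∈ Submodule.span ℂ {f' n} := by
    suffices famSpan n f' ≤ (Submodule.span ℂ {f' n}).comap
        (ρ (Bs q σ n) - c • (1 : End ℂ (Fin (2 * n) → ℂ))) from fun u hu => by simpa using this hu
    refine famSpan_le.2 fun k hk hk' => ?_
    rw [Submodule.mem_comap, LinearMap.sub_apply, hf'.Bs_apply k hk hk']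
    split_ifs with h
    · subst h
      rw [LinearMap.smul_apply, Module.End.one_apply, ← sub_smul]
      exact Submodule.smul_mem _ _ (Submodule.mem_span_singleton_self _)
    · simp
  have h4 := h3 _ (e w).2
  rw [h2, ← sub_smul, Submodule.smul_mem_iff _ (sub_ne_zero.2 hμc),
    Submodule.mem_span_singleton] at h4
  obtain ⟨d, hd⟩ := h4
  rw [← hd, map_smul, hf'.Bs_apply n hn le_rfl, if_pos rfl, smul_comm, hd, ← sub_eq_zero,
    ← sub_smul] at h2
  exact (smul_ne_zero (sub_ne_zero.2 hμ.symm) hw0) h2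

end IsWeightFamily

section Actions

variable {q σ : ℝ} {n : ℕ} {ρ : Uq q (2 * n) →ₐ[ℂ] End ℂ (Fin (2 * n) → ℂ)}

theorem uKi_vb {κ : ℂ}
    (hKi : ∀ r j, 1 ≤ r → r ≤ 2 * n → 1 ≤ j → j ≤ 2 * n →
      ρ (uKi q (2 * n) r) (vb n j) = κ ^ (-kd r j) • vb n j)
    {r : ℕ} (hr : 1 ≤ r) (hr' : r ≤ 2 * n) (j : ℕ) :
    ρ (uKi q (2 * n) r) (vb n j) = if r = j then κ⁻¹ • vb n j else vb n j := by
  by_cases hj : 1 ≤ j ∧ j ≤ 2 * n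
  · rw [hKi r j hr hr' hj.1 hj.2]
    split_ifs with h
    · rw [h, kd_self, zpow_neg_one]
    · rw [kd_of_ne h, neg_zero, zpow_zero, one_smul]
  · simp [vb_eq_zero hj]

theorem uK_vb {κ : ℂ}
    (hK : ∀ r j, 1 ≤ r → r ≤ 2 * n → 1 ≤ j → j ≤ 2 * n →
      ρ (uK q (2 * n) r) (vb n j) = κ ^ kd r j • vb n j)
    {r : ℕ} (hr : 1 ≤ r) (hr' : r ≤ 2 * n) (j : ℕ) :
    ρ (uK q (2 * n) r) (vb n j) = if r = j then κ • vb n j else vb n j := by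
  by_cases hj : 1 ≤ j ∧ j ≤ 2 * n
  · rw [hK r j hr hr' hj.1 hj.2]
    split_ifs with h
    · rw [h, kd_self, zpow_one]
    · rw [kd_of_ne h, zpow_zero, one_smul]
  · simp [vb_eq_zero hj]

theorem Cc_vb {κ : ℂ}
    (hK : ∀ r, 1 ≤ r → r ≤ 2 * n → ∀ j,
      ρ (uK q (2 * n) r) (vb n j) = if r = j then κ • vb n j else vb n j)
    {i : ℕ} (hi : 1 ≤ i) (hi' : i ≤ 2 * n) (k : ℕ) :
    ρ (Cc q n i) (vb n k) = (if i = k ∨ i + k = 2 * n + 1 then κ else 1) • vb n k := by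
  rw [Cc, map_mul, Module.End.mul_apply, hK (2 * n + 1 - i) (by omega) (by omega)]
  split_ifs <;> first | omega | (simp [hK i hi hi']; omega)

theorem Ccinv_vb {κ : ℂ}
    (hKi : ∀ r, 1 ≤ r → r ≤ 2 * n → ∀ j,
      ρ (uKi q (2 * n) r) (vb n j) = if r = j then κ⁻¹ • vb n j else vb n j)
    {i : ℕ} (hi : 1 ≤ i) (hi' : i ≤ 2 * n) (k : ℕ) :
    ρ (Ccinv q n i) (vb n k) = (if i = k ∨ i + k = 2 * n + 1 then κ⁻¹ else 1) • vb n k := by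
  rw [Ccinv, map_mul, Module.End.mul_apply, hKi (2 * n + 1 - i) (by omega) (by omega)]
  split_ifs <;> first | omega | (simp [hKi i hi hi']; omega)

theorem pair_eigen {z : Uq q (2 * n)} {d : ℂ} {t : ℂ} {i k : ℕ} (hk : 1 ≤ k) (hk' : k ≤ n)
    (h : ∀ k, ρ z (vb n k) = (if i = k ∨ i + k = 2 * n + 1 then d else 1) • vb n k) :
    ρ z (vb n k + t • vb n (2 * n + 1 - k)) =
      (if i = k ∨ i + k = 2 * n + 1 then d else 1) • (vb n k + t • vb n (2 * n + 1 - k)) := by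
  have e : (i = 2 * n + 1 - k ∨ i + (2 * n + 1 - k) = 2 * n + 1) ↔ (i = k ∨ i + k = 2 * n + 1) := by
    omega
  rw [map_add, map_smul, h, h, if_congr e rfl rfl, smul_comm t, smul_add]

theorem pair_ne_zero {t : ℂ} {k : ℕ} (hk : 1 ≤ k) (hk' : k ≤ n) :
    vb n k + t • vb n (2 * n + 1 - k) ≠ 0 := by
  intro h
  have h1 := congrFun h ⟨k - 1, by omega⟩
  have h2 : vb n (2 * n + 1 - k) ⟨k - 1, by omega⟩ = 0 :=
    vb_apply_of_ne (by simp only; omega)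
  rw [Pi.add_apply, Pi.smul_apply, h2, vb, dif_pos ⟨hk, by omega⟩] at h1
  simp at h1

end Actions

/-- The scalar by which `B_n^σ` acts on basis vectors away from the middle pair. -/
noncomputable def cShift (q σ : ℝ) : ℂ := (((q ^ (-σ) - q ^ σ) / (q - q⁻¹) : ℝ) : ℂ)

theorem Bs_eq (q σ : ℝ) (n : ℕ) : Bs q σ n =
    uF q (2 * n) n * uKi q (2 * n) (n + 1) * uKi q (2 * n) n
      + uKi q (2 * n) n * uE q (2 * n) n * uKi q (2 * n) n
      + cShift q σ • uKi q (2 * n) n ^ 2 := rfl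

theorem vector_isWeightFamily {q σ : ℝ} {n : ℕ}
    {ρ : Uq q (2 * n) →ₐ[ℂ] End ℂ (Fin (2 * n) → ℂ)} (hq : (q : ℂ) ≠ 0) (hn : 1 ≤ n)
    (hK : ∀ r, 1 ≤ r → r ≤ 2 * n → ∀ j,
      ρ (uK q (2 * n) r) (vb n j) = if r = j then (q : ℂ) • vb n j else vb n j)
    (hKi : ∀ r, 1 ≤ r → r ≤ 2 * n → ∀ j,
      ρ (uKi q (2 * n) r) (vb n j) = if r = j then (q : ℂ)⁻¹ • vb n j else vb n j)
    (hE : ∀ i j, 1 ≤ i → i + 1 ≤ 2 * n → 1 ≤ j → j ≤ 2 * n →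
      ρ (uE q (2 * n) i) (vb n j) = if i + 1 = j then vb n (j - 1) else 0)
    (hF : ∀ i j, 1 ≤ i → i + 1 ≤ 2 * n → 1 ≤ j → j ≤ 2 * n →
      ρ (uF q (2 * n) i) (vb n j) = if i = j then vb n (j + 1) else 0)
    {s : ℝ} (hs : (s : ℂ) ≠ 0)
    (hc : cShift q σ * (q - (q : ℂ)⁻¹) = (s : ℂ)⁻¹ - s) :
    IsWeightFamily q σ n ρ (wv n s) q (cShift q σ) (cShift q σ + s * (q : ℂ)⁻¹) := by
  have hB : ∀ j, 1 ≤ j → j + 1 ≤ 2 * n → j ≠ n → ∀ k, 1 ≤ k → k ≤ 2 * n →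
      ρ (Bb q n j) (vb n k) = (if j = k then vb n (j + 1) else 0) +
        if 2 * n - j + 1 = k then vb n (2 * n - j) else 0 := by
    intro j hj hj' hjn k hk hk'
    simp only [Bb, map_add, LinearMap.add_apply, map_mul, Module.End.mul_apply,
      hKi (2 * n - j) (by omega) (by omega)]
    congr 1
    · by_cases h : j = k
      · subst h
        rw [if_neg (by omega), hKi _ (by omega) (by omega), if_neg (by omega),
          hF _ _ hj hj' hk hk', if_pos rfl]
      · split_ifs <;>
        simp only [map_smul, hKi (j + 1) (by omega) (by omega)] <;> split_ifs <;>
        simp [hF _ _ hj hj' hk hk', h]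
    · by_cases h : 2 * n - j + 1 = k
      · rw [if_neg (by omega), hE _ _ (by omega) (by omega) hk hk', if_pos h,
          hKi _ (by omega) (by omega), if_neg (by omega), if_pos h, ← h, Nat.add_sub_cancel]
      · split_ifs <;> simp [hE (2 * n - j) k (by omega) (by omega) hk hk', h]
  have hBs : ∀ k, 1 ≤ k → k ≤ 2 * n → ρ (Bs q σ n) (vb n k) =
      if n = k then (q : ℂ)⁻¹ • vb n (n + 1) + (cShift q σ * (q : ℂ)⁻¹ ^ 2) • vb n k
      else if n + 1 = k then (q : ℂ)⁻¹ • vb n n + cShift q σ • vb n k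
      else cShift q σ • vb n k := by
    intro k hk hk'
    simp only [Bs_eq, map_add, LinearMap.add_apply, map_mul, Module.End.mul_apply, map_smul,
      pow_two, LinearMap.smul_apply, hKi n (by omega) (by omega)]
    by_cases h1 : n = k
    · subst h1
      simp [hKi _ (show 1 ≤ n by omega) (show n ≤ 2 * n by omega),
        hKi _ (show 1 ≤ n + 1 by omega) (show n + 1 ≤ 2 * n by omega),
        hF _ _ hn (by omega : n + 1 ≤ 2 * n) hk hk', hE _ _ hn (by omega : n + 1 ≤ 2 * n) hk hk',
        smul_smul]
    · by_cases h2 : n + 1 = k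
      · subst h2
        simp [hKi _ (show 1 ≤ n by omega) (show n ≤ 2 * n by omega),
          hKi _ (show 1 ≤ n + 1 by omega) (show n + 1 ≤ 2 * n by omega),
          hF _ _ hn (by omega : n + 1 ≤ 2 * n) hk hk',
          hE _ _ hn (by omega : n + 1 ≤ 2 * n) hk hk']
      · simp [hKi _ (show 1 ≤ n by omega) (show n ≤ 2 * n by omega),
          hKi _ (show 1 ≤ n + 1 by omega) (show n + 1 ≤ 2 * n by omega),
          hF _ _ hn (by omega : n + 1 ≤ 2 * n) hk hk',
          hE _ _ hn (by omega : n + 1 ≤ 2 * n) hk hk', h1, h2]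
  have hBup : ∀ j, 1 ≤ j → j + 1 ≤ n → ∀ k, 1 ≤ k → k ≤ n →
      ρ (Bb q n j) (wv n s k) = if j = k then wv n s (k + 1) else 0 := by
    intro j hj hj' k hk hk'
    rw [wv, map_add, map_smul, hB j hj (by omega) (by omega) _ hk (by omega),
      hB j hj (by omega) (by omega) _ (by omega) (by omega)]
    split_ifs <;> first | omega | skip
    · subst k
      rw [wv, show 2 * n + 1 - (j + 1) = 2 * n - j by omega, add_zero, zero_add]
    · simp
  have hBdown : ∀ j, n + 1 ≤ j → j + 1 ≤ 2 * n → ∀ k, 1 ≤ k → k ≤ n →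
      ρ (Bb q n j) (wv n s k) = if j + k = 2 * n + 1 then wv n s (k - 1) else 0 := by
    intro j hj hj' k hk hk'
    rw [wv, map_add, map_smul, hB j (by omega) (by omega) (by omega) _ hk (by omega),
      hB j (by omega) (by omega) (by omega) _ (by omega) (by omega)]
    split_ifs <;> first | omega | skip
    · rw [wv, show 2 * n + 1 - (k - 1) = j + 1 by omega, show 2 * n - j = k - 1 by omega,
        add_zero, zero_add]
    · simp
  refine ⟨fun i hi hi' k hk hk' => pair_eigen hk hk' (Cc_vb hK hi hi'),
    fun i hi hi' k hk hk' => pair_eigen hk hk' (Ccinv_vb hKi hi hi'),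
    fun j hj hj' hjn k hk hk' => ?_, fun k hk hk' => ?_, fun k hk hk' => ?_, fun k hk hk' => ?_,
    pair_ne_zero hn le_rfl⟩
  · rcases lt_or_gt_of_ne hjn with h | h
    · rw [hBup j hj h k hk hk']
      split_ifs
      · exact mem_famSpan (by omega) (by omega)
      · exact zero_mem _
    · rw [hBdown j h hj' k hk hk']
      split_ifs
      · exact mem_famSpan (by omega) (by omega)
      · exact zero_mem _
  · exact ⟨k, 1, hk, by omega, by omega, one_ne_zero, by
      rw [hBup k hk hk' k hk (by omega), if_pos rfl, one_smul]⟩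
  · exact ⟨2 * n - k, 1, by omega, by omega, by omega, one_ne_zero, by
      rw [hBdown _ (by omega) (by omega) _ (by omega) hk', if_pos (by omega), one_smul,
        Nat.add_sub_cancel]⟩
  · rw [wv, map_add, map_smul, hBs k hk (by omega), hBs _ (by omega) (by omega)]
    split_ifs <;> first | omega | skip
    · subst k
      rw [show 2 * n + 1 - n = n + 1 by omega]
      have h1 : cShift q σ * (1 - (q : ℂ)⁻¹ ^ 2) = (q : ℂ)⁻¹ * ((s : ℂ)⁻¹ - s) := by
        rw [← hc]; field_simp
      have h2 : (s : ℂ) * (s : ℂ)⁻¹ = 1 := mul_inv_cancel₀ hs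
      match_scalars
      · linear_combination -(q : ℂ)⁻¹ * h2
      · linear_combination -h1
    · module

theorem dual_isWeightFamily {q σ : ℝ} {n : ℕ}
    {ρ : Uq q (2 * n) →ₐ[ℂ] End ℂ (Fin (2 * n) → ℂ)} (hq : (q : ℂ) ≠ 0) (hn : 1 ≤ n)
    (hK : ∀ r, 1 ≤ r → r ≤ 2 * n → ∀ j,
      ρ (uK q (2 * n) r) (vb n j) = if r = j then (q : ℂ)⁻¹ • vb n j else vb n j)
    (hKi : ∀ r, 1 ≤ r → r ≤ 2 * n → ∀ j,
      ρ (uKi q (2 * n) r) (vb n j) = if r = j then (q : ℂ)⁻¹⁻¹ • vb n j else vb n j)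
    (hE : ∀ i j, 1 ≤ i → i + 1 ≤ 2 * n → 1 ≤ j → j ≤ 2 * n →
      ρ (uE q (2 * n) i) (vb n j) = if i = j then (-(q : ℂ)⁻¹) • vb n (j + 1) else 0)
    (hF : ∀ i j, 1 ≤ i → i + 1 ≤ 2 * n → 1 ≤ j → j ≤ 2 * n →
      ρ (uF q (2 * n) i) (vb n j) = if i + 1 = j then (-(q : ℂ)) • vb n (j - 1) else 0)
    {s : ℝ} (hs : (s : ℂ) ≠ 0)
    (hc : cShift q σ * (q - (q : ℂ)⁻¹) = (s : ℂ)⁻¹ - s) :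
    IsWeightFamily q σ n ρ (wvs q n s) (q : ℂ)⁻¹ (cShift q σ) (cShift q σ - s * q) := by
  have hB : ∀ j, 1 ≤ j → j + 1 ≤ 2 * n → j ≠ n → ∀ k, 1 ≤ k → k ≤ 2 * n →
      ρ (Bb q n j) (vb n k) = (if j + 1 = k then (-(q : ℂ) ^ 2) • vb n j else 0) +
        if 2 * n - j = k then (-1 : ℂ) • vb n (2 * n - j + 1) else 0 := by
    intro j hj hj' hjn k hk hk'
    simp only [Bb, map_add, LinearMap.add_apply, map_mul, Module.End.mul_apply,
      hKi (2 * n - j) (by omega) (by omega)]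
    congr 1
    · by_cases h : j + 1 = k
      · subst h
        rw [if_neg (by omega), hKi _ (by omega) (by omega), if_pos rfl, if_pos rfl, map_smul,
          hF _ _ hj hj' hk hk', if_pos rfl, smul_smul, inv_inv, Nat.add_sub_cancel]
        ring_nf
      · split_ifs <;>
        simp only [map_smul, hKi (j + 1) (by omega) (by omega)] <;> split_ifs <;>
        simp [hF _ _ hj hj' hk hk', h]
    · by_cases h : 2 * n - j = k
      · rw [if_pos h, map_smul, hE _ _ (by omega) (by omega) hk hk', if_pos h, map_smul, map_smul,
          hKi _ (by omega) (by omega), if_neg (by omega), if_pos h, ← h, smul_smul, inv_inv,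
          mul_neg, mul_inv_cancel₀ hq]
      · simp [hE (2 * n - j) k (by omega) (by omega) hk hk', h]
  have hBs : ∀ k, 1 ≤ k → k ≤ 2 * n → ρ (Bs q σ n) (vb n k) =
      if n = k then (-1 : ℂ) • vb n (n + 1) + (cShift q σ * (q : ℂ) ^ 2) • vb n k
      else if n + 1 = k then (-(q : ℂ) ^ 2) • vb n n + cShift q σ • vb n k
      else cShift q σ • vb n k := by
    intro k hk hk'
    simp only [Bs_eq, map_add, LinearMap.add_apply, map_mul, Module.End.mul_apply, map_smul,
      pow_two, LinearMap.smul_apply, hKi n (by omega) (by omega)]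
    by_cases h1 : n = k
    · subst h1
      simp [hKi _ (show 1 ≤ n by omega) (show n ≤ 2 * n by omega),
        hKi _ (show 1 ≤ n + 1 by omega) (show n + 1 ≤ 2 * n by omega),
        hF _ _ hn (by omega : n + 1 ≤ 2 * n) hk hk', hE _ _ hn (by omega : n + 1 ≤ 2 * n) hk hk',
        smul_smul, hq, -Complex.coe_smul]
    · by_cases h2 : n + 1 = k
      · subst h2
        simp [hKi _ (show 1 ≤ n by omega) (show n ≤ 2 * n by omega),
          hKi _ (show 1 ≤ n + 1 by omega) (show n + 1 ≤ 2 * n by omega),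
          hF _ _ hn (by omega : n + 1 ≤ 2 * n) hk hk',
          hE _ _ hn (by omega : n + 1 ≤ 2 * n) hk hk', smul_smul, -Complex.coe_smul]
      · simp [hKi _ (show 1 ≤ n by omega) (show n ≤ 2 * n by omega),
          hKi _ (show 1 ≤ n + 1 by omega) (show n + 1 ≤ 2 * n by omega),
          hF _ _ hn (by omega : n + 1 ≤ 2 * n) hk hk',
          hE _ _ hn (by omega : n + 1 ≤ 2 * n) hk hk', h1, h2, -Complex.coe_smul]
  have hpow : ∀ k : ℤ, (q : ℂ) ^ (2 * (k + 1) - 2 * (n : ℤ) - 1) =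
      (q : ℂ) ^ 2 * (q : ℂ) ^ (2 * k - 2 * (n : ℤ) - 1) := by
    intro k
    rw [← zpow_natCast, ← zpow_add₀ hq]
    congr 1
    push_cast
    ring
  have hBdown : ∀ j, 1 ≤ j → j + 1 ≤ n → ∀ k, 1 ≤ k → k ≤ n →
      ρ (Bb q n j) (wvs q n s k) =
        if j + 1 = k then (-(q : ℂ) ^ 2) • wvs q n s j else 0 := by
    intro j hj hj' k hk hk'
    rw [wvs, map_add, map_smul, hB j hj (by omega) (by omega) _ hk (by omega),
      hB j hj (by omega) (by omega) _ (by omega) (by omega)]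
    split_ifs <;> first | omega | skip
    · subst k
      rw [wvs, show 2 * n - j + 1 = 2 * n + 1 - j by omega, Nat.cast_succ, hpow]
      module
    · simp
  have hBup : ∀ j, n + 1 ≤ j → j + 1 ≤ 2 * n → ∀ k, 1 ≤ k → k ≤ n →
      ρ (Bb q n j) (wvs q n s k) =
        if j + k = 2 * n then (-1 : ℂ) • wvs q n s (k + 1) else 0 := by
    intro j hj hj' k hk hk'
    rw [wvs, map_add, map_smul, hB j (by omega) (by omega) (by omega) _ hk (by omega),
      hB j (by omega) (by omega) (by omega) _ (by omega) (by omega)]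
    split_ifs <;> first | omega | skip
    · rw [wvs, show 2 * n + 1 - (k + 1) = j by omega, show 2 * n - j = k by omega,
        Nat.cast_succ, hpow]
      module
    · simp
  refine ⟨fun i hi hi' k hk hk' => pair_eigen hk hk' (Cc_vb hK hi hi'),
    fun i hi hi' k hk hk' => pair_eigen hk hk' (Ccinv_vb hKi hi hi'),
    fun j hj hj' hjn k hk hk' => ?_, fun k hk hk' => ?_, fun k hk hk' => ?_, fun k hk hk' => ?_,
    pair_ne_zero hn le_rfl⟩
  · rcases lt_or_gt_of_ne hjn with h | h
    · rw [hBdown j hj h k hk hk']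
      split_ifs
      · exact Submodule.smul_mem _ _ (mem_famSpan (by omega) (by omega))
      · exact zero_mem _
    · rw [hBup j h hj' k hk hk']
      split_ifs
      · exact Submodule.smul_mem _ _ (mem_famSpan (by omega) (by omega))
      · exact zero_mem _
  · exact ⟨2 * n - k, -1, by omega, by omega, by omega, by simp, by
      rw [hBup _ (by omega) (by omega) _ (by omega) (by omega), if_pos (by omega)]⟩
  · exact ⟨k, -(q : ℂ) ^ 2, hk, by omega, by omega, by simp [hq], by
      rw [hBdown k hk hk' _ (by omega) hk', if_pos rfl]⟩
  · rw [wvs, map_add, map_smul, hBs k hk (by omega), hBs _ (by omega) (by omega)]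
    split_ifs <;> first | omega | skip
    · subst k
      rw [show 2 * n + 1 - n = n + 1 by omega,
        show (2 * (n : ℤ) - 2 * (n : ℤ) - 1) = -1 by ring, zpow_neg_one]
      have h1 : cShift q σ * ((q : ℂ) ^ 2 - 1) = q * ((s : ℂ)⁻¹ - s) := by
        rw [← hc]; field_simp
      have h2 : (s : ℂ) * (s : ℂ)⁻¹ = 1 := mul_inv_cancel₀ hs
      have h3 : (q : ℂ) * (q : ℂ)⁻¹ = 1 := mul_inv_cancel₀ hq
      match_scalars
      · linear_combination h2 * q * (q : ℂ)⁻¹ + h3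
      · linear_combination h1 - (s : ℂ)⁻¹ * q * h3
    · module

theorem cShift_mul {q σ : ℝ} (hq0 : 0 < q) (hq1 : q < 1) :
    cShift q σ * (q - (q : ℂ)⁻¹) = ((q ^ σ : ℝ) : ℂ)⁻¹ - (q ^ σ : ℝ) := by
  have : q - q⁻¹ ≠ 0 := by
    have := one_lt_inv_iff₀.2 ⟨hq0, hq1⟩
    linarith
  rw [cShift, Real.rpow_neg hq0.le]
  exact_mod_cast div_mul_cancel₀ _ this

end QG

namespace QG

theorem ofReal_rpow_ne_zero {q : ℝ} (hq0 : 0 < q) (σ : ℝ) : ((q ^ σ : ℝ) : ℂ) ≠ 0 :=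
  Complex.ofReal_ne_zero.2 (Real.rpow_pos_of_pos hq0 σ).ne'

theorem ofReal_neg_rpow_neg {q : ℝ} (hq0 : 0 < q) (σ : ℝ) :
    ((-(q ^ (-σ)) : ℝ) : ℂ) = -((q ^ σ : ℝ) : ℂ)⁻¹ := by
  rw [Real.rpow_neg hq0.le, Complex.ofReal_neg, Complex.ofReal_inv]

theorem ofReal_rpow_ne_neg_rpow_neg {q : ℝ} (hq0 : 0 < q) (σ : ℝ) :
    ((q ^ σ : ℝ) : ℂ) ≠ ((-(q ^ (-σ)) : ℝ) : ℂ) := by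
  rw [Ne, Complex.ofReal_inj]
  have h1 := Real.rpow_pos_of_pos hq0 σ
  have h2 := Real.rpow_pos_of_pos hq0 (-σ)
  exact (by linarith : -(q ^ (-σ)) < q ^ σ).ne'

end QG

open QG in
/-- (a) The vector representation and the dual vector representation of `U_q(gl(2n))`
on `ℂ^{2n}` exist; (b) for `s = q^σ` and `s = -q^{-σ}` the subspaces `W(s)` (resp.
`W^*(s)`) are `𝒜_σ`-invariant, simple and mutually non-isomorphic as `𝒜_σ`-modules,
and `V = W(q^σ) ⊕ W(-q^{-σ})`, `V^* = W^*(q^σ) ⊕ W^*(-q^{-σ})`. -/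
theorem statement_18 (q : ℝ) (hq0 : 0 < q) (hq1 : q < 1) (n : ℕ) (hn : 1 ≤ n) (σ : ℝ) :
    (∃ ρV : Uq q (2*n) →ₐ[ℂ] Module.End ℂ (Fin (2*n) → ℂ),
      (∀ r j, 1 ≤ r → r ≤ 2*n → 1 ≤ j → j ≤ 2*n →
        ρV (uK q (2*n) r) (vb n j) = ((q : ℂ) ^ (kd r j)) • vb n j ∧
        ρV (uKi q (2*n) r) (vb n j) = ((q : ℂ) ^ (-(kd r j))) • vb n j) ∧
      (∀ i j, 1 ≤ i → i + 1 ≤ 2*n → 1 ≤ j → j ≤ 2*n →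
        ρV (uE q (2*n) i) (vb n j) = (if i + 1 = j then vb n (j-1) else 0) ∧
        ρV (uF q (2*n) i) (vb n j) = (if i = j then vb n (j+1) else 0))) ∧
    (∃ ρVs : Uq q (2*n) →ₐ[ℂ] Module.End ℂ (Fin (2*n) → ℂ),
      (∀ r j, 1 ≤ r → r ≤ 2*n → 1 ≤ j → j ≤ 2*n →
        ρVs (uK q (2*n) r) (vb n j) = ((q : ℂ) ^ (-(kd r j))) • vb n j ∧
        ρVs (uKi q (2*n) r) (vb n j) = ((q : ℂ) ^ (kd r j)) • vb n j) ∧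
      (∀ i j, 1 ≤ i → i + 1 ≤ 2*n → 1 ≤ j → j ≤ 2*n →
        ρVs (uE q (2*n) i) (vb n j) = (if i = j then (-(q : ℂ)⁻¹) • vb n (j+1) else 0) ∧
        ρVs (uF q (2*n) i) (vb n j) = (if i + 1 = j then (-(q : ℂ)) • vb n (j-1) else 0))) ∧
    (∀ ρV : Uq q (2*n) →ₐ[ℂ] Module.End ℂ (Fin (2*n) → ℂ),
      (∀ r j, 1 ≤ r → r ≤ 2*n → 1 ≤ j → j ≤ 2*n →
        ρV (uK q (2*n) r) (vb n j) = ((q : ℂ) ^ (kd r j)) • vb n j ∧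
        ρV (uKi q (2*n) r) (vb n j) = ((q : ℂ) ^ (-(kd r j))) • vb n j) →
      (∀ i j, 1 ≤ i → i + 1 ≤ 2*n → 1 ≤ j → j ≤ 2*n →
        ρV (uE q (2*n) i) (vb n j) = (if i + 1 = j then vb n (j-1) else 0) ∧
        ρV (uF q (2*n) i) (vb n j) = (if i = j then vb n (j+1) else 0)) →
      AInv q σ n ρV (Wsub n (q ^ σ)) ∧
      AInv q σ n ρV (Wsub n (-(q ^ (-σ)))) ∧
      ASimple q σ n ρV (Wsub n (q ^ σ)) ∧
      ASimple q σ n ρV (Wsub n (-(q ^ (-σ)))) ∧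
      ¬ AIso q σ n ρV (Wsub n (q ^ σ)) (Wsub n (-(q ^ (-σ)))) ∧
      Wsub n (q ^ σ) ⊔ Wsub n (-(q ^ (-σ))) = ⊤ ∧
      Wsub n (q ^ σ) ⊓ Wsub n (-(q ^ (-σ))) = ⊥) ∧
    (∀ ρVs : Uq q (2*n) →ₐ[ℂ] Module.End ℂ (Fin (2*n) → ℂ),
      (∀ r j, 1 ≤ r → r ≤ 2*n → 1 ≤ j → j ≤ 2*n →
        ρVs (uK q (2*n) r) (vb n j) = ((q : ℂ) ^ (-(kd r j))) • vb n j ∧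
        ρVs (uKi q (2*n) r) (vb n j) = ((q : ℂ) ^ (kd r j)) • vb n j) →
      (∀ i j, 1 ≤ i → i + 1 ≤ 2*n → 1 ≤ j → j ≤ 2*n →
        ρVs (uE q (2*n) i) (vb n j) = (if i = j then (-(q : ℂ)⁻¹) • vb n (j+1) else 0) ∧
        ρVs (uF q (2*n) i) (vb n j) = (if i + 1 = j then (-(q : ℂ)) • vb n (j-1) else 0)) →
      AInv q σ n ρVs (Wssub q n (q ^ σ)) ∧
      AInv q σ n ρVs (Wssub q n (-(q ^ (-σ)))) ∧
      ASimple q σ n ρVs (Wssub q n (q ^ σ)) ∧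
      ASimple q σ n ρVs (Wssub q n (-(q ^ (-σ)))) ∧
      ¬ AIso q σ n ρVs (Wssub q n (q ^ σ)) (Wssub q n (-(q ^ (-σ)))) ∧
      Wssub q n (q ^ σ) ⊔ Wssub q n (-(q ^ (-σ))) = ⊤ ∧
      Wssub q n (q ^ σ) ⊓ Wssub q n (-(q ^ (-σ))) = ⊥) := by
  have hq : (q : ℂ) ≠ 0 := Complex.ofReal_ne_zero.2 hq0.ne'
  have hqone : (q : ℂ) ≠ 1 := by exact_mod_cast hq1.ne
  have hs1 := ofReal_rpow_ne_zero hq0 σ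
  have hs2 : ((-(q ^ (-σ)) : ℝ) : ℂ) ≠ 0 := by
    rw [ofReal_neg_rpow_neg hq0]
    exact neg_ne_zero.2 (inv_ne_zero hs1)
  have hne := ofReal_rpow_ne_neg_rpow_neg hq0 σ
  have hc1 := cShift_mul (σ := σ) hq0 hq1
  have hc2 : cShift q σ * (q - (q : ℂ)⁻¹) =
      ((-(q ^ (-σ)) : ℝ) : ℂ)⁻¹ - ((-(q ^ (-σ)) : ℝ) : ℂ) := by
    rw [hc1, ofReal_neg_rpow_neg hq0, inv_neg, inv_inv]
    ring
  refine ⟨?_, ?_, fun ρ h1 h2 => ?_, fun ρ h1 h2 => ?_⟩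
  · obtain ⟨ρ, hK, hKi, hE, hF⟩ := exists_genAction_rep (n := n) (κ := q) (α := 1) (β := 1)
      hq0 hq1 (mul_one 1) (Or.inl ⟨rfl, rfl, rfl⟩)
    refine ⟨ρ, fun r j _ _ _ _ => ⟨hK r j, hKi r j⟩, fun i j _ _ hj hj' => ⟨?_, ?_⟩⟩
    · rw [hE i j hj hj', one_smul]
      exact if_ctx_congr Iff.rfl (fun h => by rw [← h, Nat.add_sub_cancel]) fun _ => rfl
    · rw [hF i j hj hj', one_smul]
      exact if_ctx_congr Iff.rfl (fun h => by rw [← h]) fun _ => rfl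
  · obtain ⟨ρ, hK, hKi, hE, hF⟩ := exists_genAction_rep (n := n) (κ := (q : ℂ)⁻¹)
      (α := -(q : ℂ)⁻¹) (β := -q) hq0 hq1 (by rw [neg_mul_neg, inv_mul_cancel₀ hq])
      (Or.inr ⟨rfl, rfl, rfl⟩)
    refine ⟨ρ, fun r j _ _ _ _ => ⟨?_, ?_⟩, fun i j _ _ hj hj' => ⟨?_, ?_⟩⟩
    · rw [hK, inv_zpow']
    · rw [hKi, inv_zpow', neg_neg]
    · rw [hE i j hj hj']
      exact if_ctx_congr Iff.rfl (fun h => by rw [← h]) fun _ => rfl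
    · rw [hF i j hj hj']
      exact if_ctx_congr Iff.rfl (fun h => by rw [← h, Nat.add_sub_cancel]) fun _ => rfl
  · have hK := fun r (hr : 1 ≤ r) (hr' : r ≤ 2 * n) => uK_vb (ρ := ρ) (κ := q)
      (fun r j hr hr' hj hj' => (h1 r j hr hr' hj hj').1) hr hr'
    have hKi := fun r (hr : 1 ≤ r) (hr' : r ≤ 2 * n) => uKi_vb (ρ := ρ) (κ := q)
      (fun r j hr hr' hj hj' => (h1 r j hr hr' hj hj').2) hr hr'
    have hE := fun i j hi hi' hj hj' => (h2 i j hi hi' hj hj').1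
    have hF := fun i j hi hi' hj hj' => (h2 i j hi hi' hj hj').2
    have hf1 := vector_isWeightFamily hq hn hK hKi hE hF hs1 hc1
    have hf2 := vector_isWeightFamily hq hn hK hKi hE hF hs2 hc2
    have hcompl := famSpan_pair_isCompl (n := n) (t := fun _ => ((q ^ σ : ℝ) : ℂ)⁻¹)
      (t' := fun _ => ((-(q ^ (-σ)) : ℝ) : ℂ)⁻¹) fun _ _ _ => inv_injective.ne hne
    refine ⟨hf1.aInv, hf2.aInv, hf1.aSimple hn hqone, hf2.aSimple hn hqone,
      hf1.not_aIso hf2 hn ?_ ?_, hcompl.1, hcompl.2⟩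
    · exact fun h => hne (mul_right_cancel₀ (inv_ne_zero hq) (add_left_cancel h))
    · exact fun h => mul_ne_zero hs1 (inv_ne_zero hq) (add_eq_left.1 h)
  · have hK := fun r (hr : 1 ≤ r) (hr' : r ≤ 2 * n) => uK_vb (ρ := ρ) (κ := (q : ℂ)⁻¹)
      (fun r j hr hr' hj hj' => by rw [(h1 r j hr hr' hj hj').1, inv_zpow']) hr hr'
    have hKi := fun r (hr : 1 ≤ r) (hr' : r ≤ 2 * n) => uKi_vb (ρ := ρ) (κ := (q : ℂ)⁻¹)
      (fun r j hr hr' hj hj' => by rw [(h1 r j hr hr' hj hj').2, inv_zpow', neg_neg]) hr hr'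
    have hE := fun i j hi hi' hj hj' => (h2 i j hi hi' hj hj').1
    have hF := fun i j hi hi' hj hj' => (h2 i j hi hi' hj hj').2
    have hf1 := dual_isWeightFamily hq hn hK hKi hE hF hs1 hc1
    have hf2 := dual_isWeightFamily hq hn hK hKi hE hF hs2 hc2
    have hcompl := famSpan_pair_isCompl (n := n)
      (t := fun i => ((q ^ σ : ℝ) : ℂ)⁻¹ * (q : ℂ) ^ (2 * (i : ℤ) - 2 * (n : ℤ) - 1))
      (t' := fun i => ((-(q ^ (-σ)) : ℝ) : ℂ)⁻¹ * (q : ℂ) ^ (2 * (i : ℤ) - 2 * (n : ℤ) - 1))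
      fun _ _ _ h => inv_injective.ne hne (mul_right_cancel₀ (zpow_ne_zero _ hq) h)
    have hqinv : (q : ℂ)⁻¹ ≠ 1 := inv_ne_one.2 hqone
    refine ⟨hf1.aInv, hf2.aInv, hf1.aSimple hn hqinv, hf2.aSimple hn hqinv,
      hf1.not_aIso hf2 hn ?_ ?_, hcompl.1, hcompl.2⟩
    · exact fun h => hne (mul_right_cancel₀ hq (sub_right_injective h))
    · exact fun h => mul_ne_zero hs1 hq (sub_eq_self.1 h)
end
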